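/- Let k be a finite field of characteristic p ≥ 5 and let n ≥ 2. Then the group cohomology of the finite group GL(n,k) with coefficients in the adjoint representation gl_n satisfies: H^0(GL(n,k), gl_n) and H^2(GL(n,k), gl_n) are 1-dimensional over k, while H^1(GL(n,k), gl_n) = 0 and H^3(GL(n,k), gl_n) = 0. -/

import Mathlib

open scoped MatrixGroups TensorProduct

noncomputable section

/-- The adjoint (conjugation) representation of `GL(n,k)` on `gl_n`. -/
def glConj (k : Type) [Field k] (n : ℕ) :
    Representation k (GL (Fin n) k) (Matrix (Fin n) (Fin n) k) where
  toFun g :=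
    { toFun := fun x => (g : Matrix (Fin n) (Fin n) k) * x * (↑g⁻¹ : Matrix (Fin n) (Fin n) k)
      map_add' := fun x y => by noncomm_ring
      map_smul' := fun c x => by simp [Matrix.smul_mul, Matrix.mul_smul] }
  map_one' := by ext x; simp
  map_mul' g h := by
    ext x
    simp [Matrix.mul_assoc]

variable (k : Type) [Field k] {G : Type} [Group G]
variable (V : Type) [AddCommGroup V] [Module k V]

/-- The `m`-th tensor power of a representation (diagonal action). -/
def tpowRep (m : ℕ) (ρ : Representation k G V) :
    Representation k G (⨂[k] (_ : Fin m), V) :=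
  PiTensorProduct.mapMonoidHom.comp (Pi.monoidHom fun _ => ρ)

lemma tpowRep_apply (m : ℕ) (ρ : Representation k G V) (g : G) (f : Fin m → V) :
    tpowRep k V m ρ g (PiTensorProduct.tprod k f)
      = PiTensorProduct.tprod k (fun i => ρ g (f i)) := by
  exact PiTensorProduct.map_tprod (fun _ => ρ g) f

/-- The subspace of the `m`-th tensor power by which one quotients to obtain
the `m`-th symmetric power. -/
def symPowSub (m : ℕ) : Submodule k (⨂[k] (_ : Fin m), V) :=
  Submodule.span k {z | ∃ (σ : Equiv.Perm (Fin m)) (f : Fin m → V),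
    z = PiTensorProduct.tprod k f - PiTensorProduct.tprod k (f ∘ σ)}

/-- The `m`-th symmetric power of a `k`-vector space. -/
abbrev SymPow (m : ℕ) := (⨂[k] (_ : Fin m), V) ⧸ symPowSub k V m

/-- The `m`-th symmetric power of a representation. -/
def symPowRep (m : ℕ) (ρ : Representation k G V) :
    Representation k G (SymPow k V m) where
  toFun g := Submodule.mapQ _ _ (tpowRep k V m ρ g) (by
    rw [symPowSub, Submodule.span_le]
    rintro z ⟨σ, f, rfl⟩
    simp only [SetLike.mem_coe, Submodule.mem_comap, map_sub, tpowRep_apply]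
    refine Submodule.subset_span ⟨σ, fun i => ρ g (f i), ?_⟩
    simp [Function.comp_def])
  map_one' := by
    refine Submodule.linearMap_qext _ ?_
    refine PiTensorProduct.ext ?_
    ext f
    simp [Submodule.mapQ_apply, tpowRep_apply]
  map_mul' g h := by
    refine Submodule.linearMap_qext _ ?_
    refine PiTensorProduct.ext ?_
    ext f
    simp [Submodule.mapQ_apply, tpowRep_apply]

/-- The subspace of the `m`-th tensor power by which one quotients to obtain
the `m`-th exterior power: the span of pure tensors with two equal entries. -/
def altPowSub (m : ℕ) : Submodule k (⨂[k] (_ : Fin m), V) :=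
  Submodule.span k {z | ∃ (f : Fin m → V) (i j : Fin m), i ≠ j ∧ f i = f j ∧
    z = PiTensorProduct.tprod k f}

/-- The `m`-th exterior power of a `k`-vector space. -/
abbrev AltPow (m : ℕ) := (⨂[k] (_ : Fin m), V) ⧸ altPowSub k V m

/-- The `m`-th exterior power of a representation. -/
def altPowRep (m : ℕ) (ρ : Representation k G V) :
    Representation k G (AltPow k V m) where
  toFun g := Submodule.mapQ _ _ (tpowRep k V m ρ g) (by
    rw [altPowSub, Submodule.span_le]
    rintro z ⟨f, i, j, hij, hfij, rfl⟩
    simp only [SetLike.mem_coe, Submodule.mem_comap, tpowRep_apply]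
    exact Submodule.subset_span ⟨fun i => ρ g (f i), i, j, hij, by simp only [hfij], rfl⟩)
  map_one' := by
    refine Submodule.linearMap_qext _ (PiTensorProduct.ext ?_)
    ext f
    simp [Submodule.mapQ_apply, tpowRep_apply]
  map_mul' g h := by
    refine Submodule.linearMap_qext _ (PiTensorProduct.ext ?_)
    ext f
    simp [Submodule.mapQ_apply, tpowRep_apply]

/-- The second divided power `Γ²V ⊆ V ⊗ V`: tensors invariant under the flip. -/
def gamma2 : Submodule k (V ⊗[k] V) :=
  LinearMap.eqLocus (TensorProduct.comm k V V).toLinearMap LinearMap.id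

lemma comm_comp_map (f : V →ₗ[k] V) :
    (TensorProduct.comm k V V).toLinearMap ∘ₗ TensorProduct.map f f
      = TensorProduct.map f f ∘ₗ (TensorProduct.comm k V V).toLinearMap :=
  TensorProduct.ext' fun x y => by simp

lemma gamma2_stable (f : V →ₗ[k] V) :
    ∀ z ∈ gamma2 k V, TensorProduct.map f f z ∈ gamma2 k V := by
  intro z hz
  have h1 : (TensorProduct.comm k V V).toLinearMap z = z := hz
  have h2 := congrArg (fun φ => φ z) (comm_comp_map k V f)
  simp only [LinearMap.comp_apply] at h2
  rw [h1] at h2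
  exact h2

/-- The second divided power of a representation. -/
def gamma2Rep (ρ : Representation k G V) : Representation k G (gamma2 k V) where
  toFun g := ((ρ.tprod ρ) g).restrict (p := gamma2 k V) (q := gamma2 k V)
    (gamma2_stable k V (ρ g))
  map_one' := by
    ext z
    simp [LinearMap.restrict_apply, Representation.tprod_apply]
  map_mul' g h := by
    ext z
    simp only [LinearMap.restrict_apply, Representation.tprod_apply, map_mul,
      Module.End.mul_apply, LinearMap.coe_mk, AddHom.coe_mk, Submodule.coe_subtype]

namespace GLC
open CategoryTheory

section
variable {K Γ A B C : Type} [Field K] [Group Γ]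
  [AddCommGroup A] [Module K A] [AddCommGroup B] [Module K B] [AddCommGroup C] [Module K C]

/-- length of cohomology -/
def cd (ρ : Representation K Γ A) (j : ℕ) : ℕ∞ :=
  Module.length K (groupCohomology (Rep.of ρ) j)

/-- equivariance -/
def Eqv (ρ : Representation K Γ A) (σ : Representation K Γ B) (f : A →ₗ[K] B) : Prop :=
  ∀ g a, f (ρ g a) = σ g (f a)

def mkHom {ρ : Representation K Γ A} {σ : Representation K Γ B} {f : A →ₗ[K] B}
    (hf : Eqv ρ σ f) : Rep.of ρ ⟶ Rep.of σ :=
  Rep.ofHom ⟨f, fun g => by ext a; exact hf g a⟩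

lemma cd_retract {ρ : Representation K Γ A} {σ : Representation K Γ B}
    (i : A →ₗ[K] B) (hi : Eqv ρ σ i) (p : B →ₗ[K] A) (hp : Eqv σ ρ p) (h : ∀ a, p (i a) = a)
    (j : ℕ) : cd ρ j ≤ cd σ j := by
  have h1 : mkHom hi ≫ mkHom hp = 𝟙 _ := by
    ext a
    exact h a
  have h2 := (((groupCohomology.functor K Γ j).map_comp (mkHom hi) (mkHom hp)).symm.trans
    (congrArg (fun f => ((groupCohomology.functor K Γ j).map f)) h1)).trans
    ((groupCohomology.functor K Γ j).map_id _)
  refine Module.length_le_of_injective ((groupCohomology.functor K Γ j).map (mkHom hi)).hom ?_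
  refine Function.LeftInverse.injective (g := ((groupCohomology.functor K Γ j).map (mkHom hp)).hom) ?_
  intro x
  have := congrArg (fun f => f.hom x) h2
  exact this

lemma cd_iso {ρ : Representation K Γ A} {σ : Representation K Γ B}
    (e : A ≃ₗ[K] B) (hi : Eqv ρ σ e) (j : ℕ) : cd ρ j = cd σ j := by
  have hi' : Eqv σ ρ (e.symm : B →ₗ[K] A) := by
    intro g b
    apply e.injective
    have := hi g (e.symm b)
    simp at this
    simp [this]
  exact le_antisymm (cd_retract _ hi _ hi' (by simp) j) (cd_retract _ hi' _ hi (by simp) j)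

/-- short exact sequences -/
structure SES (ρ : Representation K Γ A) (σ : Representation K Γ B) (τ : Representation K Γ C)
    (f : A →ₗ[K] B) (g : B →ₗ[K] C) : Prop where
  hf : Eqv ρ σ f
  hg : Eqv σ τ g
  inj : Function.Injective f
  surj : Function.Surjective g
  ex : ∀ b, g b = 0 ↔ ∃ a, f a = b

lemma LES {ρ : Representation K Γ A} {σ : Representation K Γ B} {τ : Representation K Γ C}
    {f : A →ₗ[K] B} {g : B →ₗ[K] C} (h : SES ρ σ τ f g) :
    ∃ (F : ∀ j, groupCohomology (Rep.of ρ) j →ₗ[K] groupCohomology (Rep.of σ) j)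
      (G : ∀ j, groupCohomology (Rep.of σ) j →ₗ[K] groupCohomology (Rep.of τ) j)
      (D : ∀ j, groupCohomology (Rep.of τ) j →ₗ[K] groupCohomology (Rep.of ρ) (j+1)),
      Function.Injective (F 0) ∧ (∀ j, Function.Exact (F j) (G j)) ∧
      (∀ j, Function.Exact (G j) (D j)) ∧ (∀ j, Function.Exact (D j) (F (j+1))) := by
  have hz : mkHom h.hf ≫ mkHom h.hg = 0 := by
    ext a
    exact (h.ex _).2 ⟨a, rfl⟩
  let X : ShortComplex (Rep K Γ) := ⟨mkHom h.hf, mkHom h.hg, hz⟩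
  have hX : X.ShortExact := by
    have e1 : X.Exact := by
      rw [← ShortComplex.exact_map_iff_of_faithful X (forget₂ (Rep K Γ) (ModuleCat K)),
        ShortComplex.moduleCat_exact_iff]
      intro x hx
      exact (h.ex x).1 hx
    exact { exact := e1, mono_f := (Rep.mono_iff_injective X.f).2 h.inj,
            epi_g := (Rep.epi_iff_surjective X.g).2 h.surj }
  refine ⟨fun j => ((groupCohomology.functor K Γ j).map X.f).hom,
    fun j => ((groupCohomology.functor K Γ j).map X.g).hom,
    fun j => (groupCohomology.δ hX j (j+1) rfl).hom, ?_, ?_, ?_, ?_⟩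
  · have := (Rep.mono_iff_injective X.f).2 h.inj
    have : Mono ((groupCohomology.functor K Γ 0).map X.f) :=
      groupCohomology.mono_map_0_of_mono X.f
    exact (ModuleCat.mono_iff_injective _).1 this
  · intro j
    exact (ShortComplex.ShortExact.moduleCat_exact_iff_function_exact _).1 (groupCohomology.mapShortComplex₂_exact hX j)
  · intro j
    exact (ShortComplex.ShortExact.moduleCat_exact_iff_function_exact _).1 (groupCohomology.mapShortComplex₃_exact hX rfl)
  · intro j
    exact (ShortComplex.ShortExact.moduleCat_exact_iff_function_exact _).1 (groupCohomology.mapShortComplex₁_exact hX rfl)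

end
end GLC

namespace GLC
open CategoryTheory

section
variable {K Γ A B C : Type} [Field K] [Group Γ]
  [AddCommGroup A] [Module K A] [AddCommGroup B] [Module K B] [AddCommGroup C] [Module K C]

lemma length_mid {f : A →ₗ[K] B} {g : B →ₗ[K] C} (h : Function.Exact f g) :
    Module.length K B ≤ Module.length K A + Module.length K C := by
  have e := Module.length_eq_add_of_exact (LinearMap.ker g).subtype g.rangeRestrict
    (Submodule.subtype_injective _) g.surjective_rangeRestrict (by
      intro b
      simp [Subtype.ext_iff])
  rw [e]
  have hk : LinearMap.ker g = LinearMap.range f := by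
    ext x; exact h x
  refine add_le_add ?_ (Module.length_le_of_injective (LinearMap.range g).subtype
    (Submodule.subtype_injective _))
  rw [hk]
  exact Module.length_le_of_surjective f.rangeRestrict f.surjective_rangeRestrict

section
variable {ρ : Representation K Γ A} {σ : Representation K Γ B} {τ : Representation K Γ C}
    {f : A →ₗ[K] B} {g : B →ₗ[K] C}

lemma SES.A0 (h : SES ρ σ τ f g) : cd ρ 0 ≤ cd σ 0 := by
  obtain ⟨F, G, D, h0, h1, h2, h3⟩ := LES h
  exact Module.length_le_of_injective _ h0

lemma SES.A1 (h : SES ρ σ τ f g) (j : ℕ) : cd ρ (j+1) ≤ cd τ j + cd σ (j+1) := by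
  obtain ⟨F, G, D, h0, h1, h2, h3⟩ := LES h
  exact length_mid (h3 j)

lemma SES.mid (h : SES ρ σ τ f g) (j : ℕ) : cd σ j ≤ cd ρ j + cd τ j := by
  obtain ⟨F, G, D, h0, h1, h2, h3⟩ := LES h
  exact length_mid (h1 j)

lemma SES.C1 (h : SES ρ σ τ f g) (j : ℕ) : cd τ j ≤ cd σ j + cd ρ (j+1) := by
  obtain ⟨F, G, D, h0, h1, h2, h3⟩ := LES h
  exact length_mid (h2 j)

lemma surj_of_length_le {X Y : Type} [AddCommGroup X] [Module K X] [AddCommGroup Y] [Module K Y]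
    (f : X →ₗ[K] Y) (hi : Function.Injective f) (hl : Module.length K Y ≤ Module.length K X)
    (hX : Module.length K Y ≠ ⊤) : Function.Surjective f := by
  have e := Module.length_eq_add_of_exact f (LinearMap.range f).mkQ hi
    (Submodule.mkQ_surjective _) (by intro b; simp)
  have hX' : Module.length K X ≠ ⊤ := ne_top_of_le_ne_top hX (Module.length_le_of_injective f hi)
  have h0 : Module.length K (Y ⧸ LinearMap.range f) = 0 := by
    rw [e] at hl
    by_contra h
    have h1 : 1 ≤ Module.length K (Y ⧸ LinearMap.range f) := Order.one_le_iff_ne_zero.2 h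
    have := (add_le_add_right h1 (Module.length K X)).trans hl
    exact absurd (ENat.add_one_le_iff hX' |>.1 this) (lt_irrefl _)
  rw [Module.length_eq_zero_iff, Submodule.Quotient.subsingleton_iff] at h0
  exact LinearMap.range_eq_top.1 h0

lemma SES.C0 (h : SES ρ σ τ f g) (h1 : cd σ 0 ≤ cd ρ 0) (h2 : cd σ 0 ≠ ⊤) (h3 : cd ρ 1 = 0) :
    cd τ 0 = 0 := by
  obtain ⟨F, G, D, e0, e1, e2, e3⟩ := LES h
  have hs := surj_of_length_le (F 0) e0 h1 h2
  have hsub : Subsingleton (groupCohomology (Rep.of ρ) 1) := Module.length_eq_zero_iff.1 h3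
  rw [cd, Module.length_eq_zero_iff]
  refine ⟨fun x y => ?_⟩
  have : ∀ x : groupCohomology (Rep.of τ) 0, x = 0 := by
    intro x
    obtain ⟨b, rfl⟩ := (e2 0 x).1 (Subsingleton.elim _ _)
    obtain ⟨a, rfl⟩ := hs b
    exact (e1 0 _).2 ⟨a, rfl⟩
  rw [this x, this y]

lemma SES.refd (h : SES ρ σ τ f g) (h1 : cd σ 0 = 0) (h2 : cd ρ 1 ≤ cd τ 0) (h3 : cd ρ 1 ≠ ⊤) :
    cd σ 1 ≤ cd τ 1 := by
  obtain ⟨F, G, D, e0, e1, e2, e3⟩ := LES h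
  have hsub : Subsingleton (groupCohomology (Rep.of σ) 0) := Module.length_eq_zero_iff.1 h1
  have hD : Function.Injective (D 0) := by
    rw [injective_iff_map_eq_zero]
    intro x hx
    obtain ⟨b, rfl⟩ := (e2 0 x).1 hx
    rw [Subsingleton.elim b 0, map_zero]
  have hs := surj_of_length_le (D 0) hD h2 h3
  refine Module.length_le_of_injective (G 1) ?_
  rw [injective_iff_map_eq_zero]
  intro x hx
  obtain ⟨a, rfl⟩ := (e1 1 x).1 hx
  obtain ⟨c, rfl⟩ := hs a
  exact (e3 0 _).2 ⟨c, rfl⟩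

lemma cd_zero_of_subsingleton [Subsingleton A] (ρ : Representation K Γ A) (j : ℕ) : cd ρ j = 0 := by
  have h : SES ρ ρ ρ (0 : A →ₗ[K] A) 0 :=
    ⟨fun _ _ => Subsingleton.elim _ _, fun _ _ => Subsingleton.elim _ _,
      Function.injective_of_subsingleton _, Function.surjective_to_subsingleton _,
      fun b => ⟨fun _ => ⟨0, Subsingleton.elim _ _⟩, fun _ => Subsingleton.elim _ _⟩⟩
  have hz : mkHom h.hf = 𝟙 _ := by ext a; exact Subsingleton.elim _ _
  have hz' : mkHom h.hf = 0 := by ext a; exact Subsingleton.elim _ _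
  have h2 := ((groupCohomology.functor K Γ j).map_id (Rep.of ρ)).symm.trans
    (congrArg (fun f => ((groupCohomology.functor K Γ j).map f)) (hz.symm.trans hz'))
  rw [cd, Module.length_eq_zero_iff]
  have h3 : (groupCohomology.functor K Γ j).map (0 : Rep.of ρ ⟶ Rep.of ρ) = 0 :=
    (groupCohomology.functor K Γ j).map_zero _ _
  have h4 := h2.trans h3
  refine ⟨fun x y => ?_⟩
  have key : ∀ x : groupCohomology (Rep.of ρ) j, x = 0 := fun x =>
    congrArg (fun f => f.hom x) h4
  rw [key x, key y]

end

/-- restriction -/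
def rs {Δ : Type} [Group Δ] (φ : Δ →* Γ) (ρ : Representation K Γ A) : Representation K Δ A :=
  MonoidHom.comp ρ φ

@[simp] lemma rs_apply {Δ : Type} [Group Δ] (φ : Δ →* Γ) (ρ : Representation K Γ A) (g : Δ) (a : A) :
    rs φ ρ g a = ρ (φ g) a := rfl

lemma Eqv.rs {Δ : Type} [Group Δ] (φ : Δ →* Γ) {ρ : Representation K Γ A}
    {σ : Representation K Γ B} {f : A →ₗ[K] B} (h : Eqv ρ σ f) : Eqv (rs φ ρ) (rs φ σ) f :=
  fun g a => h (φ g) a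

lemma SES.rs {Δ : Type} [Group Δ] (φ : Δ →* Γ) {ρ : Representation K Γ A}
    {σ : Representation K Γ B} {τ : Representation K Γ C}
    {f : A →ₗ[K] B} {g : B →ₗ[K] C} (h : SES ρ σ τ f g) :
    SES (rs φ ρ) (rs φ σ) (rs φ τ) f g :=
  ⟨h.hf.rs φ, h.hg.rs φ, h.inj, h.surj, h.ex⟩

lemma cd_groupIso {Δ : Type} [Group Δ] (e : Δ ≃* Γ) (ρ : Representation K Γ A) (j : ℕ) :
    cd (rs (e : Δ →* Γ) ρ) j = cd ρ j := by
  have i := groupCohomology.mapIso (A := Rep.of ρ) (B := Rep.of (rs (e : Δ →* Γ) ρ)) e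
    (LinearEquiv.refl K A) (fun g => by ext; rfl) j
  exact i.toLinearEquiv.length_eq

lemma cd_H0 (ρ : Representation K Γ A) : cd ρ 0 = Module.length K ρ.invariants :=
  (groupCohomology.H0Iso (Rep.of ρ)).toLinearEquiv.length_eq

lemma cd_H0_zero {ρ : Representation K Γ A} : cd ρ 0 = 0 ↔ ∀ a, (∀ g, ρ g a = a) → a = 0 := by
  rw [cd_H0, Module.length_eq_zero_iff, Submodule.subsingleton_iff_eq_bot, Submodule.eq_bot_iff]
  rfl

lemma cd_H0_le (ρ : Representation K Γ A) : cd ρ 0 ≤ Module.length K A := by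
  rw [cd_H0]
  exact Module.length_le_of_injective (Submodule.subtype _) (Submodule.subtype_injective _)

lemma cd_H0_triv {ρ : Representation K Γ A} (h : ∀ g a, ρ g a = a) :
    cd ρ 0 = Module.length K A := by
  refine le_antisymm (cd_H0_le ρ) ?_
  rw [cd_H0]
  exact Module.length_le_of_injective (LinearMap.codRestrict _ LinearMap.id (fun a g => h g a))
    (fun a b hab => congrArg Subtype.val hab)

end

section
variable {K Γ M Ω : Type} [Field K] [Group Γ] [AddCommGroup M] [Module K M]

/-- functions on a Γ-set with values in M -/
def funRep (s : Γ →* Equiv.Perm Ω) (ρ : Representation K Γ M) : Representation K Γ (Ω → M) where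
  toFun g :=
    { toFun := fun f ω => ρ g (f (s g⁻¹ ω))
      map_add' := fun f f' => by ext; simp
      map_smul' := fun c f => by ext; simp }
  map_one' := by ext; simp
  map_mul' g h := by
    refine LinearMap.ext fun f => funext fun ω => ?_
    simp

@[simp] lemma funRep_apply (s : Γ →* Equiv.Perm Ω) (ρ : Representation K Γ M) (g : Γ) (f : Ω → M)
    (ω : Ω) : funRep s ρ g f ω = ρ g (f (s g⁻¹ ω)) := rfl

lemma shapiro (s : Γ →* Equiv.Perm Ω) (ρ : Representation K Γ M) (ω₀ : Ω)
    (tr : ∀ ω, ∃ g, s g ω₀ = ω) (S : Subgroup Γ) (hS : ∀ g, g ∈ S ↔ s g ω₀ = ω₀) (j : ℕ) :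
    cd (funRep s ρ) j = cd (rs S.subtype ρ) j := by
  let σ := Representation.coind S.subtype (rs S.subtype ρ)
  have h1 : cd σ j = cd (rs S.subtype ρ) j :=
    (groupCohomology.coindIso (Rep.of (rs S.subtype ρ)) j).toLinearEquiv.length_eq
  rw [← h1]
  choose t ht using tr
  have hinv : ∀ g : Γ, ∀ ω, s g⁻¹ (s g ω) = ω := fun g ω => by simp
  have hmul : ∀ (g h : Γ) ω, s (g * h) ω = s g (s h ω) := fun g h ω => by simp
  let F : (Ω → M) →ₗ[K] Representation.coindV S.subtype (rs S.subtype ρ) :=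
    { toFun := fun f => ⟨fun h => ρ h (f (s h⁻¹ ω₀)), by
        rintro ⟨g, hg⟩ h
        have := (hS g⁻¹).1 (S.inv_mem hg)
        simp only [Subgroup.coe_subtype, rs_apply, mul_inv_rev, hmul, this]
        simp⟩
      map_add' := fun f f' => by ext; simp
      map_smul' := fun c f => by ext; simp }
  have hF : Function.Bijective F := by
    constructor
    · intro f f' hff
      funext ω
      have h2 := congrFun (congrArg Subtype.val hff) (t ω)⁻¹
      simp only [F, LinearMap.coe_mk, AddHom.coe_mk, inv_inv, ht] at h2
      exact (ρ.apply_bijective _).1 h2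
    · rintro ⟨φ, hφ⟩
      refine ⟨fun ω => ρ (t ω) (φ (t ω)⁻¹), ?_⟩
      ext h
      simp only [F, LinearMap.coe_mk, AddHom.coe_mk]
      set u := t (s h⁻¹ ω₀) with hu
      have hmem : h * u ∈ S := by
        rw [hS, hmul, hu, ht]
        simpa using hinv h⁻¹ ω₀
      have := hφ ⟨h * u, hmem⟩ u⁻¹
      simp only [Subgroup.coe_subtype, rs_apply, mul_inv_cancel_right] at this
      rw [this]
      simp
  refine cd_iso (LinearEquiv.ofBijective F hF) ?_ j
  intro g f
  ext h
  simp only [F, σ, LinearEquiv.ofBijective_apply, LinearMap.coe_mk, AddHom.coe_mk, LinearEquiv.coe_coe]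
  change ρ h (ρ g (f (s g⁻¹ (s h⁻¹ ω₀)))) = ρ (h * g) (f (s (h * g)⁻¹ ω₀))
  simp

variable (K Ω M) in
def constMap : M →ₗ[K] (Ω → M) := LinearMap.pi fun _ => LinearMap.id

@[simp] lemma constMap_apply (m : M) (ω : Ω) : constMap K M Ω m ω = m := rfl

lemma constMap_eqv (s : Γ →* Equiv.Perm Ω) (ρ : Representation K Γ M) :
    Eqv ρ (funRep s ρ) (constMap K M Ω) := fun g a => rfl

lemma transfer_aux [Fintype Ω] (s : Γ →* Equiv.Perm Ω) (ρ : Representation K Γ M)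
    (hc : (Fintype.card Ω : K) ≠ 0) (j : ℕ) : cd ρ j ≤ cd (funRep s ρ) j := by
  let p : (Ω → M) →ₗ[K] M := (Fintype.card Ω : K)⁻¹ • ∑ ω, LinearMap.proj ω
  refine cd_retract _ (constMap_eqv s ρ) p ?_ ?_ j
  · intro g f
    simp only [p, LinearMap.smul_apply, LinearMap.sum_apply, LinearMap.proj_apply, funRep_apply,
      map_smul, map_sum]
    congr 1
    exact Equiv.sum_comp (s g⁻¹) (fun ω => ρ g (f ω))
  · intro a
    simp only [p, LinearMap.smul_apply, LinearMap.sum_apply, LinearMap.proj_apply, constMap_apply,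
      Finset.sum_const, Finset.card_univ]
    rw [← Nat.cast_smul_eq_nsmul K, smul_smul, inv_mul_cancel₀ hc, one_smul]

/-- action on cosets -/
def cosetPerm (S : Subgroup Γ) : Γ →* Equiv.Perm (Γ ⧸ S) := MulAction.toPermHom Γ (Γ ⧸ S)

lemma cosetPerm_apply (S : Subgroup Γ) (g h : Γ) : cosetPerm S g (h : Γ ⧸ S) = ((g * h : Γ) : Γ ⧸ S) := rfl

lemma shapiro_coset (S : Subgroup Γ) (ρ : Representation K Γ M) (j : ℕ) :
    cd (funRep (cosetPerm S) ρ) j = cd (rs S.subtype ρ) j := by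
  refine shapiro _ ρ ((1 : Γ) : Γ ⧸ S) ?_ S ?_ j
  · intro ω
    induction ω using QuotientGroup.induction_on with
    | H z => exact ⟨z, by rw [cosetPerm_apply, mul_one]⟩
  · intro g
    rw [cosetPerm_apply, mul_one, eq_comm, QuotientGroup.eq]
    simp

lemma transfer [Finite Γ] (S : Subgroup Γ) (ρ : Representation K Γ M)
    (hc : (S.index : K) ≠ 0) (j : ℕ) : cd ρ j ≤ cd (rs S.subtype ρ) j := by
  rw [← shapiro_coset S ρ j]
  haveI := Fintype.ofFinite (Γ ⧸ S)
  refine transfer_aux _ ρ ?_ j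
  rwa [← Nat.card_eq_fintype_card]

lemma cd_trivial_group [Subsingleton Γ] (ρ : Representation K Γ M) (j : ℕ) : cd ρ (j+1) = 0 := by
  rw [cd, Module.length_eq_zero_iff]
  exact ModuleCat.subsingleton_of_isZero
    (isZero_groupCohomology_succ_of_subsingleton (Rep.of ρ) j)

lemma cd_prime_to_p [Finite Γ] (ρ : Representation K Γ M) (hc : (Nat.card Γ : K) ≠ 0) (j : ℕ) :
    cd ρ (j+1) = 0 := by
  have := transfer (⊥ : Subgroup Γ) ρ (by rwa [Subgroup.index_bot]) (j+1)
  rw [cd_trivial_group (Γ := (⊥ : Subgroup Γ))] at this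
  exact le_antisymm this zero_le

/-- product representation -/
def piRep {ι : Type} (ρ : ι → Representation K Γ M) : Representation K Γ (ι → M) where
  toFun g :=
    { toFun := fun f i => ρ i g (f i)
      map_add' := fun f f' => by ext; simp
      map_smul' := fun c f => by ext; simp }
  map_one' := by ext; simp
  map_mul' g h := by
    refine LinearMap.ext fun f => funext fun ω => ?_
    simp

@[simp] lemma piRep_apply {ι : Type} (ρ : ι → Representation K Γ M) (g : Γ) (f : ι → M) (i : ι) :
    piRep ρ g f i = ρ i g (f i) := rfl

lemma cd_piRep {ι : Type} [Finite ι] (ρ : ι → Representation K Γ M) (j : ℕ)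
    (h : ∀ i, cd (ρ i) j = 0) : cd (piRep ρ) j = 0 := by
  revert ρ
  refine Finite.induction_empty_option (P := fun ι => ∀ ρ : ι → Representation K Γ M,
    (∀ i, cd (ρ i) j = 0) → cd (piRep ρ) j = 0) ?_ ?_ ?_ ι
  · intro α β e ih ρ hρ
    rw [← ih (fun a => ρ (e a)) (fun a => hρ _)]
    symm
    refine cd_iso (LinearEquiv.funCongrLeft K M e.symm) ?_ j
    intro g f
    funext i
    simp [LinearEquiv.funCongrLeft, LinearMap.funLeft]
  · intro ρ _
    exact cd_zero_of_subsingleton _ _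
  · intro α _ ih ρ hρ
    have hs : SES (ρ none) (piRep ρ) (piRep fun a => ρ (some a))
        (LinearMap.pi fun i => Option.casesOn i LinearMap.id fun _ => 0)
        (LinearMap.funLeft K M some) := by
      refine ⟨?_, ?_, ?_, ?_, ?_⟩
      · intro g a
        funext i
        cases i <;> simp
      · intro g f
        funext i
        simp [LinearMap.funLeft]
      · intro a b hab
        simpa using congrFun hab none
      · intro f
        exact ⟨fun i => Option.casesOn i 0 f, rfl⟩
      · intro f
        constructor
        · intro hf
          refine ⟨f none, ?_⟩
          funext i
          cases i with
          | none => simp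
          | some i => simpa [LinearMap.funLeft] using (congrFun hf i).symm
        · rintro ⟨a, rfl⟩
          funext i
          simp [LinearMap.funLeft]
    have := hs.mid j
    rw [hρ, ih _ (fun a => hρ _), add_zero] at this
    exact le_antisymm this zero_le

end
end GLC

namespace GLC

section
variable {K Γ A B : Type} [Field K] [Group Γ]
  [AddCommGroup A] [Module K A] [AddCommGroup B] [Module K B]

/-- cokernel representation -/
def cok {ρ : Representation K Γ A} {σ : Representation K Γ B} {f : A →ₗ[K] B} (hf : Eqv ρ σ f) :
    Representation K Γ (B ⧸ LinearMap.range f) :=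
  σ.quotient (LinearMap.range f) (by
    rintro g _ ⟨a, rfl⟩
    exact ⟨ρ g a, hf g a⟩)

lemma cok_ses {ρ : Representation K Γ A} {σ : Representation K Γ B} {f : A →ₗ[K] B}
    (hf : Eqv ρ σ f) (hi : Function.Injective f) : SES ρ σ (cok hf) f (LinearMap.range f).mkQ :=
  ⟨hf, fun _ _ => rfl, hi, Submodule.mkQ_surjective _, fun b => by simp⟩

end

section
variable {K Γ M Ω : Type} [Field K] [Group Γ] [AddCommGroup M] [Module K M]

lemma constMap_inj [Nonempty Ω] : Function.Injective (constMap K M Ω) := by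
  intro a b h
  exact congrFun h (Classical.arbitrary Ω)

lemma cok_const_zero [Finite Ω] (s : Γ →* Equiv.Perm Ω) (ρ : Representation K Γ M) (ω₀ : Ω)
    {Δ : Type} [Group Δ] (φ : Δ →* Γ) (hφ : ∀ d, s (φ d) = 1) (j : ℕ)
    (h : cd (rs φ ρ) j = 0) : cd (rs φ (cok (constMap_eqv s ρ))) j = 0 := by
  have h1 : cd (rs φ (funRep s ρ)) j = 0 := by
    have e : rs φ (funRep s ρ) = piRep (fun _ : Ω => rs φ ρ) := by
      ext d f ω
      simp [hφ]
    rw [e]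
    exact cd_piRep _ j fun _ => h
  rw [← nonpos_iff_eq_zero, ← h1]
  let i : ((Ω → M) ⧸ LinearMap.range (constMap K M Ω)) →ₗ[K] (Ω → M) :=
    Submodule.liftQ _ (LinearMap.id - (constMap K M Ω) ∘ₗ (LinearMap.proj ω₀)) (by
      rintro _ ⟨a, rfl⟩
      ext ω
      simp)
  have hi : ∀ f : Ω → M, i (Submodule.Quotient.mk f) = f - constMap K M Ω (f ω₀) := fun f => rfl
  refine cd_retract i ?_ (Submodule.mkQ _) ?_ ?_ j
  · intro d x
    induction x using Submodule.Quotient.induction_on with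
    | H f =>
      have : (rs φ (cok (constMap_eqv s ρ))) d (Submodule.Quotient.mk f)
        = Submodule.Quotient.mk (funRep s ρ (φ d) f) := rfl
      rw [this, hi, hi]
      ext ω
      simp [hφ]
  · intro d f
    rfl
  · intro x
    induction x using Submodule.Quotient.induction_on with
    | H f =>
      rw [hi, Submodule.mkQ_apply, Submodule.Quotient.eq]
      exact ⟨-f ω₀, by ext; simp⟩

end

section
variable {K Γ M : Type} [Field K] [Group Γ] [AddCommGroup M] [Module K M]

lemma cosetPerm_trivial (R S : Subgroup Γ) [R.Normal] (hRS : R ≤ S) (r : R) :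
    cosetPerm S (R.subtype r) = 1 := by
  ext ω
  induction ω using QuotientGroup.induction_on with
  | H z =>
    rw [cosetPerm_apply, Equiv.Perm.one_apply, QuotientGroup.eq]
    apply hRS
    have := Subgroup.Normal.conj_mem (inferInstance : R.Normal) _ (R.inv_mem r.2) z⁻¹
    simpa [mul_assoc] using this

lemma lemV [Finite Γ] (R : Subgroup Γ) [R.Normal] (m : ℕ) :
    ∀ {M : Type} [AddCommGroup M] [Module K M] (ρ : Representation K Γ M),
    (∀ i ≤ m, cd (rs R.subtype ρ) i = 0) → cd ρ m = 0 := by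
  induction m with
  | zero =>
    intro M _ _ ρ h
    have h1 := (cok_ses (constMap_eqv (cosetPerm R) ρ) constMap_inj).A0
    rw [shapiro_coset, h 0 le_rfl] at h1
    exact le_antisymm h1 zero_le
  | succ m ih =>
    intro M _ _ ρ h
    have h1 := (cok_ses (constMap_eqv (cosetPerm R) ρ) constMap_inj).A1 m
    rw [shapiro_coset, h (m+1) le_rfl, add_zero, ih] at h1
    · exact le_antisymm h1 zero_le
    · intro i hi
      exact cok_const_zero _ _ ((1 : Γ) : Γ ⧸ R) _ (cosetPerm_trivial R R le_rfl) _ (h i (by omega))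

lemma lemV' [Finite Γ] (R S : Subgroup Γ) [R.Normal] (hRS : R ≤ S) (m : ℕ)
    (ρ : Representation K Γ M)
    (h : ∀ i ≤ m, cd (rs R.subtype ρ) i = 0) : cd ρ (m+1) ≤ cd (rs S.subtype ρ) (m+1) := by
  have h1 := (cok_ses (constMap_eqv (cosetPerm S) ρ) constMap_inj).A1 m
  rw [shapiro_coset, lemV R m (cok _), zero_add] at h1
  · exact h1
  · intro i hi
    exact cok_const_zero _ _ ((1 : Γ) : Γ ⧸ S) _ (cosetPerm_trivial R S hRS) _ (h i (by omega))

lemma lemC [Finite Γ] [FiniteDimensional K M] (R H : Subgroup Γ) [R.Normal]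
    (hRH : ∀ g : Γ, ∃ r ∈ R, ∃ h ∈ H, g = r * h) (hd : ∀ g, g ∈ R → g ∈ H → g = 1)
    (m : ℕ) (ρ : Representation K Γ M) (htriv : ∀ r ∈ R, ∀ x, ρ r x = x)
    (h1 : ∀ i, 1 ≤ i → i ≤ m + 1 → cd (rs R.subtype ρ) i = 0)
    (h2 : ∀ i, 1 ≤ i → i ≤ m + 1 → cd (rs H.subtype ρ) i = 0) : cd ρ (m+1) = 0 := by
  have ses := (cok_ses (constMap_eqv (cosetPerm H) ρ) constMap_inj)
  have e1 := ses.A1 m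
  rw [shapiro_coset, h2 (m+1) (by omega) le_rfl, add_zero] at e1
  have sesR := ses.rs R.subtype
  have hJ : ∀ j, cd (rs R.subtype (funRep (cosetPerm H) ρ)) j
      = cd (rs (⊥ : Subgroup R).subtype (rs R.subtype ρ)) j := by
    intro j
    have : rs R.subtype (funRep (cosetPerm H) ρ)
      = funRep ((cosetPerm H).comp R.subtype) (rs R.subtype ρ) := rfl
    rw [this]
    refine shapiro _ _ ((1 : Γ) : Γ ⧸ H) ?_ _ ?_ j
    · intro ω
      induction ω using QuotientGroup.induction_on with
      | H z =>
        obtain ⟨r, hr, h, hh, rfl⟩ := hRH z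
        refine ⟨⟨r, hr⟩, ?_⟩
        simp only [MonoidHom.comp_apply, Subgroup.coe_subtype]
        rw [cosetPerm_apply, mul_one, QuotientGroup.eq]
        simpa using hh
    · intro r
      simp only [MonoidHom.comp_apply, Subgroup.coe_subtype]
      rw [cosetPerm_apply, mul_one, eq_comm, QuotientGroup.eq, Subgroup.mem_bot]
      constructor
      · rintro rfl
        simp
      · intro hr
        exact Subtype.ext (hd _ r.2 (by simpa using hr))
  have e2 : cd (cok (constMap_eqv (cosetPerm H) ρ)) m = 0 := by
    refine lemV R m _ ?_
    intro i hi
    cases i with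
    | zero =>
      refine sesR.C0 ?_ ?_ (h1 1 le_rfl (by omega))
      · rw [hJ, cd_H0_triv (ρ := rs R.subtype ρ) (fun g a => htriv _ g.2 a)]
        exact cd_H0_le _
      · rw [hJ]
        exact ne_top_of_le_ne_top Module.length_ne_top (cd_H0_le _)
    | succ i =>
      have := sesR.C1 (i+1)
      rw [hJ, cd_trivial_group (Γ := (⊥ : Subgroup R)), h1 (i+1+1) (by omega) (by omega)] at this
      exact le_antisymm (by simpa using this) zero_le
  rw [e2] at e1
  exact le_antisymm e1 zero_le

end
end GLC

namespace GLC

section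
variable {K Γ A B C Ω : Type} [Field K] [Group Γ]
  [AddCommGroup A] [Module K A] [AddCommGroup B] [Module K B] [AddCommGroup C] [Module K C]

/-- twist by a character -/
def twist (χ : Γ →* Kˣ) (ρ : Representation K Γ A) : Representation K Γ A where
  toFun g := (χ g : K) • ρ g
  map_one' := by ext; simp
  map_mul' g h := by
    ext x
    simp [smul_smul, mul_comm]

@[simp] lemma twist_apply (χ : Γ →* Kˣ) (ρ : Representation K Γ A) (g : Γ) (a : A) :
    twist χ ρ g a = (χ g : K) • ρ g a := rfl

lemma twist_twist (χ ψ : Γ →* Kˣ) (ρ : Representation K Γ A) :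
    twist χ (twist ψ ρ) = twist (χ * ψ) ρ := by
  ext g a
  simp [smul_smul]

lemma Eqv.twist (χ : Γ →* Kˣ) {ρ : Representation K Γ A} {σ : Representation K Γ B}
    {f : A →ₗ[K] B} (h : Eqv ρ σ f) : Eqv (twist χ ρ) (twist χ σ) f := by
  intro g a
  simp [h g a]

lemma Eqv.func (s : Γ →* Equiv.Perm Ω) {ρ : Representation K Γ A} {σ : Representation K Γ B}
    {f : A →ₗ[K] B} (h : Eqv ρ σ f) : Eqv (funRep s ρ) (funRep s σ) (f.compLeft Ω) := by
  intro g a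
  ext ω
  exact h g _

lemma SES.twist (χ : Γ →* Kˣ) {ρ : Representation K Γ A}
    {σ : Representation K Γ B} {τ : Representation K Γ C}
    {f : A →ₗ[K] B} {g : B →ₗ[K] C} (h : SES ρ σ τ f g) :
    SES (twist χ ρ) (twist χ σ) (twist χ τ) f g :=
  ⟨h.hf.twist χ, h.hg.twist χ, h.inj, h.surj, h.ex⟩

lemma SES.func (s : Γ →* Equiv.Perm Ω) {ρ : Representation K Γ A}
    {σ : Representation K Γ B} {τ : Representation K Γ C}
    {f : A →ₗ[K] B} {g : B →ₗ[K] C} (h : SES ρ σ τ f g) :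
    SES (funRep s ρ) (funRep s σ) (funRep s τ) (f.compLeft Ω) (g.compLeft Ω) := by
  refine ⟨h.hf.func s, h.hg.func s, h.inj.comp_left, h.surj.comp_left, ?_⟩
  intro b
  constructor
  · intro hb
    choose a ha using fun ω => (h.ex (b ω)).1 (congrFun hb ω)
    exact ⟨a, funext ha⟩
  · rintro ⟨a, rfl⟩
    ext ω
    exact (h.ex _).2 ⟨a ω, rfl⟩

/-- one-dimensional representation -/
def chi (χ : Γ →* Kˣ) : Representation K Γ K where
  toFun g := (χ g : K) • LinearMap.id
  map_one' := by ext; simp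
  map_mul' g h := by
    ext
    simp [mul_comm]

@[simp] lemma chi_apply (χ : Γ →* Kˣ) (g : Γ) (a : K) :
    chi χ g a = (χ g : K) * a := rfl

end

section poly
open Polynomial
variable {K : Type} [Field K]

lemma hasse_X_mul (j : ℕ) (f : K[X]) (a b : K) :
    hasseDeriv (j+1) ((C a * X + C b) * f) =
      (C a * X + C b) * hasseDeriv (j+1) f + C a * hasseDeriv j f := by
  ext n
  have h1 : ∀ (g : K[X]) , ((C a * X + C b) * g) = C a * (X * g) + C b * g := by intro g; ring
  simp only [h1, hasseDeriv_coeff, coeff_add, coeff_C_mul]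
  rw [show n + (j+1) = (n+j)+1 by ring, coeff_X_mul]
  cases n with
  | zero =>
    simp
    ring
  | succ n =>
    simp only [coeff_X_mul, hasseDeriv_coeff]
    rw [show n + 1 + j + 1 = (n + 1 + j) + 1 by ring, show n + (j+1) = n+1+j by ring,
      Nat.choose_succ_succ]
    push_cast
    ring

lemma hasse_comp (a b : K) (f : K[X]) : ∀ j : ℕ,
    hasseDeriv j (f.comp (C a * X + C b)) = C (a^j) * (hasseDeriv j f).comp (C a * X + C b) := by
  induction f using Polynomial.induction_on' with
  | add p q hp hq => intro j; simp [hp, hq, mul_add]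
  | monomial n c =>
    have : monomial n c = c • (X : K[X])^n := by simp [smul_X_eq_monomial]
    rw [this]
    intro j
    simp only [smul_comp, map_smul, mul_smul_comm]
    congr 1
    clear this
    induction n generalizing j with
    | zero =>
      cases j with
      | zero => simp
      | succ j =>
        have : hasseDeriv (j+1) (1 : K[X]) = 0 := by
          ext n
          rw [hasseDeriv_coeff, coeff_one, if_neg (by omega)]
          simp
        simp [this]
    | succ n ih =>
      cases j with
      | zero => simp
      | succ j =>
        have e := hasse_X_mul j (X^n : K[X]) 1 0
        simp only [map_one, one_mul, map_zero, add_zero] at e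
        rw [pow_succ', e, mul_comp, X_comp, hasse_X_mul, ih, ih]
        simp
        ring

lemma choose_ne (p : ℕ) [hp : Fact p.Prime] (a b : ℕ) (h : ∀ n < b, ¬ p ∣ (n+a).choose a) (t : ℕ) :
    ∀ n < b * p^t, ¬ p ∣ (n + a * p^t).choose (a * p^t) := by
  induction t with
  | zero => simpa using h
  | succ t ih =>
    intro n hn
    have hpos := hp.out.pos
    have h1 := ih (n / p) (by
      rw [Nat.div_lt_iff_lt_mul hpos]
      calc n < _ := hn
        _ = _ := by ring)
    have h2 : a * p^(t+1) = p * (a * p^t) := by ring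
    have h3 := Choose.choose_modEq_choose_mod_mul_choose_div_nat (p := p) (n := n + a * p^(t+1))
      (k := a * p^(t+1))
    rw [h2] at h3 ⊢
    rw [Nat.mul_mod_right, Nat.choose_zero_right, one_mul, Nat.mul_div_cancel_left _ hpos,
      Nat.add_mul_div_left _ _ hpos] at h3
    intro hd
    exact h1 ((h3.dvd_iff (dvd_refl p)).1 hd)

end poly

section polyrep
open Polynomial
variable {K Γ Ω : Type} [Field K] [Group Γ]

/-- data of an affine action -/
structure Aff (l : Γ →* Kˣ) (t : Γ → K) : Prop where
  mul : ∀ g h, t (g * h) = (l g : K) * t h + t g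

lemma Aff.one {l : Γ →* Kˣ} {t : Γ → K} (h : Aff l t) : t 1 = 0 := by
  have := h.mul 1 1
  simpa using this

def affP (l : Γ →* Kˣ) (t : Γ → K) (g : Γ) : K[X] := C (l g : K) * X + C (t g)

lemma affP_comp {l : Γ →* Kˣ} {t : Γ → K} (h : Aff l t) (g g' : Γ) :
    (affP l t g).comp (affP l t g') = affP l t (g * g') := by
  simp [affP, h.mul]
  ring

lemma natDegree_affP (l : Γ →* Kˣ) (t : Γ → K) (g : Γ) : (affP l t g).natDegree = 1 :=
  natDegree_linear (Units.ne_zero _)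

def polyRep {l : Γ →* Kˣ} {t : Γ → K} (h : Aff l t) (N : ℕ) : Representation K Γ (degreeLT K N) where
  toFun g :=
    { toFun := fun f => ⟨f.1.comp (affP l t g⁻¹), by
        by_cases hf : f.1 = 0
        · rw [hf]; simp
        have h1 := mem_degreeLT.1 f.2
        rw [mem_degreeLT]
        refine lt_of_le_of_lt degree_le_natDegree ?_
        rw [natDegree_comp, natDegree_affP, mul_one, ← degree_eq_natDegree hf]
        exact h1⟩
      map_add' := fun f f' => by ext; simp
      map_smul' := fun c f => by ext; simp }
  map_one' := by
    ext f : 2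
    simp [affP, h.one]
  map_mul' g g' := by
    ext f : 2
    simp [comp_assoc, affP_comp h]

@[simp] lemma polyRep_coe {l : Γ →* Kˣ} {t : Γ → K} (h : Aff l t) (N : ℕ) (g : Γ) (f : degreeLT K N) :
    (polyRep h N g f : K[X]) = f.1.comp (affP l t g⁻¹) := by
  simp only [polyRep, MonoidHom.coe_mk, OneHom.coe_mk, LinearMap.coe_mk, AddHom.coe_mk]

lemma mem_dlt {N : ℕ} {f : K[X]} : f ∈ degreeLT K N ↔ ∀ n, N ≤ n → f.coeff n = 0 := by
  rw [mem_degreeLT, degree_lt_iff_coeff_zero]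

lemma hasse_ker (a b : ℕ) (hab : ∀ n < b, ((n+a).choose a : K) ≠ 0) (f : K[X])
    (hf : f ∈ degreeLT K (a+b)) (h0 : hasseDeriv a f = 0) : f ∈ degreeLT K a := by
  rw [mem_dlt] at hf ⊢
  intro n hn
  by_cases hn' : a + b ≤ n
  · exact hf n hn'
  obtain ⟨i, rfl⟩ := Nat.exists_eq_add_of_le' hn
  have h1 : (hasseDeriv a f).coeff i = 0 := by rw [h0, coeff_zero]
  rw [hasseDeriv_coeff] at h1
  exact (mul_eq_zero.1 h1).resolve_left (hab i (by omega))

lemma hasse_ker' (a : ℕ) (f : K[X]) (hf : f ∈ degreeLT K a) : hasseDeriv a f = 0 := by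
  rw [mem_dlt] at hf
  ext n
  rw [hasseDeriv_coeff, hf _ (by omega), mul_zero, coeff_zero]

lemma poly_ses {l : Γ →* Kˣ} {t : Γ → K} (h : Aff l t) (a b : ℕ)
    (hab : ∀ n < b, ((n+a).choose a : K) ≠ 0) :
    ∃ f g, SES (polyRep h a) (polyRep h (a+b)) (twist (l⁻¹^a) (polyRep h b)) f g := by
  let g : degreeLT K (a+b) →ₗ[K] degreeLT K b := (hasseDeriv a).restrict (by
    intro f hf
    rw [mem_dlt] at hf ⊢
    intro n hn
    rw [hasseDeriv_coeff, hf _ (by omega), mul_zero])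
  have hg : ∀ f : degreeLT K (a+b), (g f : K[X]) = hasseDeriv a f.1 := fun f =>
    LinearMap.restrict_coe_apply _ _ _
  refine ⟨Submodule.inclusion (degreeLT_mono (by omega)), g, ?_, ?_, ?_, ?_, ?_⟩
  · intro γ f
    apply Subtype.ext
    rw [Submodule.coe_inclusion, polyRep_coe, polyRep_coe, Submodule.coe_inclusion]
  · intro γ f
    apply Subtype.ext
    simp only [hg, polyRep_coe, twist_apply, Submodule.coe_smul]
    rw [affP, hasse_comp, ← affP, C_mul']
    simp
  · exact Submodule.inclusion_injective _
  · intro y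
    refine ⟨⟨∑ n ∈ Finset.range b, monomial (n+a) (y.1.coeff n / ((n+a).choose a : K)), ?_⟩, ?_⟩
    · refine Submodule.sum_mem _ fun n hn => ?_
      rw [mem_dlt]
      intro i hi
      rw [coeff_monomial, if_neg]
      have := Finset.mem_range.1 hn
      omega
    · ext n
      rw [hg, hasseDeriv_coeff]
      simp only [finsetSum_coeff, coeff_monomial, add_left_inj]
      rw [Finset.sum_ite_eq']
      split_ifs with hn
      · have := hab n (Finset.mem_range.1 hn)
        field_simp
      · rw [mem_dlt.1 y.2 n (by simpa using hn), mul_zero]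
  · intro f
    constructor
    · intro hf
      refine ⟨⟨f.1, hasse_ker a b hab f.1 f.2 ?_⟩, Subtype.ext (Submodule.coe_inclusion _ _)⟩
      rw [← hg, hf, ZeroMemClass.coe_zero]
    · rintro ⟨x, rfl⟩
      apply Subtype.ext
      rw [hg, Submodule.coe_inclusion, hasse_ker' a x.1 x.2, ZeroMemClass.coe_zero]

end polyrep
end GLC

namespace GLC

/-- numerical system coming from the filtration of function spaces -/
structure Sys {X : Type} [CommGroup X] (m r p : ℕ) (lam : ℕ → X) (T : X → Prop)
    (B : ℕ → ℕ → X → ℕ → ℕ∞) : Prop where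
  h0 : ∀ l < m, ∀ t < r, ∀ χ, B l t χ 0 ≤ B l (t+1) χ 0
  h1 : ∀ l < m, ∀ t < r, ∀ χ, B l t χ 1 ≤ B l (t+1) (χ * (lam l)⁻¹^(p^t)) 0 + B l (t+1) χ 1
  h2 : ∀ l < m, ∀ t < r, ∀ χ j, B l t χ (j+2) ≤ B l t (χ * (lam l)⁻¹^(p^(t+1))) j +
    B l (t+1) (χ * (lam l)⁻¹^(p^t)) (j+1) + B l (t+1) χ (j+2)
  hB : ∀ l < m, ∀ χ j, B l r χ j = B (l+1) 0 χ j
  hend : ∀ χ j, B m 0 χ (j+1) = 0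
  e1 : ∀ χ, B m 0 χ 0 ≤ 1
  e0 : ∀ χ, B m 0 χ 0 ≠ 0 → T χ

namespace Sys
variable {X : Type} [CommGroup X] {m r p : ℕ} {lam : ℕ → X} {T : X → Prop}
    {B : ℕ → ℕ → X → ℕ → ℕ∞} (h : Sys m r p lam T B)
include h

/-- downward induction on stages -/
lemma down (Q : ℕ → ℕ → Prop) (q0 : Q m 0) (q1 : ∀ l < m, Q (l+1) 0 → Q l r)
    (q2 : ∀ l < m, ∀ t < r, Q l (t+1) → Q l t) : (∀ l ≤ m, Q l 0) ∧ ∀ l < m, ∀ t ≤ r, Q l t := by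
  clear h
  have key : ∀ l < m, Q (l+1) 0 → ∀ t ≤ r, Q l t := by
    intro l hl hq t ht
    induction ht using Nat.decreasingInduction with
    | self => exact q1 l hl hq
    | of_succ i hi ih => exact q2 l hl i hi ih
  have a : ∀ l ≤ m, Q l 0 := by
    intro l hl
    induction hl using Nat.decreasingInduction with
    | self => exact q0
    | of_succ i hi ih => exact key i hi ih 0 (Nat.zero_le _)
  exact ⟨a, fun l hl t ht => key l hl (a _ hl) t ht⟩

lemma van (P : ℕ → ℕ → X → ℕ → Prop) (p0 : ∀ χ, T χ → P m 0 χ 0)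
    (p1 : ∀ l < m, ∀ χ j, P (l+1) 0 χ j → P l r χ j)
    (p2 : ∀ l < m, ∀ t < r, ∀ χ j, P l (t+1) χ j → P l t χ j)
    (p3 : ∀ l < m, ∀ t < r, ∀ χ j, P l (t+1) (χ * (lam l)⁻¹^(p^t)) j → P l t χ (j+1))
    (p4 : ∀ l < m, ∀ t < r, ∀ χ j, P l t (χ * (lam l)⁻¹^(p^(t+1))) j → P l t χ (j+2)) :
    (∀ l ≤ m, ∀ χ j, B l 0 χ j ≠ 0 → P l 0 χ j) ∧
      ∀ l < m, ∀ t ≤ r, ∀ χ j, B l t χ j ≠ 0 → P l t χ j := by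
  refine h.down (fun l t => ∀ χ j, B l t χ j ≠ 0 → P l t χ j) ?_ ?_ ?_
  · intro χ j hne
    cases j with
    | zero => exact p0 χ (h.e0 χ hne)
    | succ j => exact absurd (h.hend χ j) hne
  · intro l hl ih χ j hne
    rw [h.hB l hl] at hne
    exact p1 l hl χ j (ih χ j hne)
  · intro l hl t ht ih χ j
    induction j using Nat.strong_induction_on generalizing χ with
    | _ j ihj =>
      intro hne
      match j, ihj, hne with
      | 0, _, hne =>
        exact p2 l hl t ht χ 0 (ih χ 0 fun h0 => hne (le_zero_iff.1 ((h.h0 l hl t ht χ).trans h0.le)))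
      | 1, _, hne =>
        by_contra hP
        apply hne
        have a1 : B l (t+1) (χ * (lam l)⁻¹^(p^t)) 0 = 0 := by
          by_contra hc
          exact hP (p3 l hl t ht χ 0 (ih _ _ hc))
        have a2 : B l (t+1) χ 1 = 0 := by
          by_contra hc
          exact hP (p2 l hl t ht χ 1 (ih _ _ hc))
        have := h.h1 l hl t ht χ
        rw [a1, a2, add_zero] at this
        exact le_zero_iff.1 this
      | j+2, ihj, hne =>
        by_contra hP
        apply hne
        have a1 : B l (t+1) (χ * (lam l)⁻¹^(p^t)) (j+1) = 0 := by
          by_contra hc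
          exact hP (p3 l hl t ht χ (j+1) (ih _ _ hc))
        have a2 : B l (t+1) χ (j+2) = 0 := by
          by_contra hc
          exact hP (p2 l hl t ht χ _ (ih _ _ hc))
        have a3 : B l t (χ * (lam l)⁻¹^(p^(t+1))) j = 0 := by
          by_contra hc
          exact hP (p4 l hl t ht χ _ (ihj j (by omega) _ hc))
        have := h.h2 l hl t ht χ j
        rw [a1, a2, a3, add_zero, add_zero] at this
        exact le_zero_iff.1 this

lemma le_one : (∀ l ≤ m, ∀ χ, B l 0 χ 0 ≤ 1) ∧ ∀ l < m, ∀ t ≤ r, ∀ χ, B l t χ 0 ≤ 1 :=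
  h.down (fun l t => ∀ χ, B l t χ 0 ≤ 1) h.e1 (fun l hl ih χ => by rw [h.hB l hl]; exact ih χ)
    (fun l hl t ht ih χ => (h.h0 l hl t ht χ).trans (ih χ))

lemma van0 : (∀ l ≤ m, ∀ χ, B l 0 χ 0 ≠ 0 → T χ) ∧ ∀ l < m, ∀ t ≤ r, ∀ χ, B l t χ 0 ≠ 0 → T χ := by
  have := h.van (fun l t χ j => j = 0 → T χ) (fun χ hχ _ => hχ) (fun _ _ _ _ a => a)
    (fun _ _ _ _ _ _ a => a) (by simp) (by simp)
  exact ⟨fun l hl χ hn => this.1 l hl χ 0 hn rfl, fun l hl t ht χ hn => this.2 l hl t ht χ 0 hn rfl⟩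

variable {Y : Type} [CommGroup Y]

lemma zpow_frob {z : Y} (hz : z^p = z) : ∀ t, z^(p^t) = z := by
  clear h
  intro t
  induction t with
  | zero => simp
  | succ t ih => rw [pow_succ, pow_mul, ih, hz]

lemma van1 (ev : X →* Y) (z : Y) (hz : z^p = z) (hl : ∀ l < m, ev (lam l) = z)
    (hT : ∀ χ, T χ → ev χ = 1) :
    (∀ l ≤ m, ∀ χ j, B l 0 χ j ≠ 0 → ∃ i, j ≤ 2*i ∧ i ≤ j ∧ ev χ = z^i) ∧
      ∀ l < m, ∀ t ≤ r, ∀ χ j, B l t χ j ≠ 0 → ∃ i, j ≤ 2*i ∧ i ≤ j ∧ ev χ = z^i := by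
  have fr := h.zpow_frob hz
  refine h.van (fun l t χ j => ∃ i, j ≤ 2*i ∧ i ≤ j ∧ ev χ = z^i) (fun χ hχ => ⟨0, by simp [hT χ hχ]⟩)
    (fun _ _ _ _ a => a) (fun _ _ _ _ _ _ a => a) ?_ ?_
  · rintro l hlm t ht χ j ⟨i, h1, h2, h3⟩
    refine ⟨i+1, by omega, by omega, ?_⟩
    rw [map_mul, map_pow, map_inv, hl l hlm, inv_pow, fr, mul_inv_eq_iff_eq_mul] at h3
    rw [h3, pow_succ]
  · rintro l hlm t ht χ j ⟨i, h1, h2, h3⟩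
    refine ⟨i+1, by omega, by omega, ?_⟩
    rw [map_mul, map_pow, map_inv, hl l hlm, inv_pow, fr, mul_inv_eq_iff_eq_mul] at h3
    rw [h3, pow_succ]

/-- counts -/
lemma counts (hr : 0 < r) (hp : 2 ≤ p) (χ : X) (hl : ∀ l < m, lam l = χ)
    (hT : ∀ e : ℕ, T (χ * χ⁻¹^e) → (p^r - 1 : ℤ) ∣ (e : ℤ) - 1)
    (hv : ∀ t < r, ∀ l < m, B l (t+1) (χ * χ⁻¹^(p^t)) 1 = 0) :
    B 0 0 χ 1 ≤ m ∧ B 0 0 χ 2 ≤ m := by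
  have hT1 : ∀ e, 2 ≤ e → e < p^r → ∀ l < m, ∀ t ≤ r, B l t (χ * χ⁻¹^e) 0 = 0 := by
    intro e he1 he2 l hlm t ht
    by_contra hc
    have h1 := hT e (h.van0.2 l hlm t ht _ hc)
    have h2 := Int.le_of_dvd (by omega) h1
    have : (e:ℤ) < p^r := by exact_mod_cast he2
    omega
  have step1 : ∀ l < m, B l 0 χ 1 ≤ 1 + B (l+1) 0 χ 1 := by
    intro l hlm
    have a : ∀ t ≤ r, 1 ≤ t → B l t χ 1 ≤ B l r χ 1 := by
      intro t ht
      induction ht using Nat.decreasingInduction with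
      | self => intro _; exact le_rfl
      | of_succ i hi ih =>
        intro h1
        have := h.h1 l hlm i hi χ
        rw [hl l hlm, hT1 (p^i) ?_ ?_ l hlm (i+1) hi, zero_add] at this
        · exact this.trans (ih (by omega))
        · calc 2 ≤ p := hp
            _ = p^1 := (pow_one p).symm
            _ ≤ p^i := Nat.pow_le_pow_right (by omega) h1
        · exact Nat.pow_lt_pow_right (by omega) hi
    have b := h.h1 l hlm 0 hr χ
    rw [← h.hB l hlm]
    exact b.trans (add_le_add (h.le_one.2 l hlm _ hr _) (a 1 hr le_rfl))
  have step2 : ∀ l < m, B l 0 χ 2 ≤ 1 + B (l+1) 0 χ 2 := by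
    intro l hlm
    have key : ∀ t < r, B l t χ 2 ≤ B l t (χ * χ⁻¹^(p^(t+1))) 0 + B l (t+1) χ 2 := by
      intro t ht
      have := h.h2 l hlm t ht χ 0
      rw [hl l hlm, hv t ht l hlm, add_zero] at this
      exact this
    obtain ⟨r', rfl⟩ : ∃ r', r = r' + 1 := ⟨r - 1, by omega⟩
    have a : ∀ t ≤ r', B l t χ 2 ≤ B l r' χ 2 := by
      intro t ht
      induction ht using Nat.decreasingInduction with
      | self => exact le_rfl
      | of_succ i hi ih =>
        have := key i (by omega)
        rw [hT1 (p^(i+1)) ?_ ?_ l hlm i (by omega), zero_add] at this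
        · exact this.trans ih
        · calc 2 ≤ p := hp
            _ = p^1 := (pow_one p).symm
            _ ≤ p^(i+1) := Nat.pow_le_pow_right (by omega) (by omega)
        · exact Nat.pow_lt_pow_right (by omega) (by omega)
    rw [← h.hB l hlm]
    exact (a 0 (Nat.zero_le _)).trans ((key r' (by omega)).trans
      (add_le_add (h.le_one.2 l hlm _ (by omega) _) le_rfl))
  have fin : ∀ j, 1 ≤ j → (∀ l < m, B l 0 χ j ≤ 1 + B (l+1) 0 χ j) → B 0 0 χ j ≤ m := by
    intro j hj hs
    have a : ∀ l ≤ m, B l 0 χ j ≤ ((m - l : ℕ) : ℕ∞) := by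
      intro l hl
      induction hl using Nat.decreasingInduction with
      | self =>
        obtain ⟨j, rfl⟩ : ∃ i, j = i + 1 := ⟨j - 1, by omega⟩
        rw [h.hend]; simp
      | of_succ i hi ih =>
        refine (hs i hi).trans ((add_le_add le_rfl ih).trans ?_)
        have : m - i = 1 + (m - (i+1)) := by omega
        rw [this]; push_cast; rfl
    exact a 0 (Nat.zero_le _)
  exact ⟨fin 1 le_rfl step1, fin 2 (by norm_num) step2⟩

/-- the delicate vanishing statement in degree three -/
lemma van3 (hr : 0 < r) (hp : 5 ≤ p) (ev' : X →* Y) (ev : Y → X →* Y) (z : Y) (hz : z^p = z)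
    (hzo : orderOf z = p - 1) (hex : ∃ y : Y, orderOf y = p^r - 1) (a : ℕ)
    (he1 : ∀ l < m, l ≠ a → ev' (lam l) = z⁻¹) (he2 : ev' (lam a) = 1)
    (he3 : ∀ y, ev y (lam a) = y⁻¹) (he4 : ∀ y, ∀ l < m, l ≠ a → ev y (lam l) = 1)
    (hT' : ∀ χ, T χ → ev' χ = 1) (hT : ∀ χ, T χ → ∀ y, ev y χ = 1) (χ : X)
    (h1 : ev' χ = 1) (h2 : ∀ y, ev y χ = y) : B 0 0 χ 3 = 0 := by
  have fr := h.zpow_frob hz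
  obtain ⟨b, rfl⟩ : ∃ b, p = b + 1 := ⟨p - 1, by omega⟩
  rw [Nat.add_sub_cancel] at hzo
  let bd : ℕ → ℕ → ℕ := fun l t => if a < l then (b+1)^r else if l = a then (b+1)^t else 1
  have hpp : ∀ t, 1 ≤ (b+1)^t := fun t => Nat.one_le_pow _ _ (by omega)
  let P : ℕ → ℕ → X → ℕ → Prop := fun l t χ j => ∃ c d e : ℕ, j ≤ 2*(c+d) ∧ c + d ≤ j ∧
    ev' χ * z^d = 1 ∧ ev z χ * z^c = 1 ∧ (∀ y, ev y χ * y^e = 1) ∧ (c = j → b*e + bd l t ≤ (b+1)^r)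
  have hP := h.van P ?_ ?_ ?_ ?_ ?_
  · by_contra hne
    obtain ⟨c, d, e, k1, k2, k3, k4, k5, k6⟩ := hP.1 0 (Nat.zero_le _) χ 3 hne
    rw [h1, one_mul] at k3
    have d0 : d = 0 := by
      have := orderOf_dvd_of_pow_eq_one k3
      rw [hzo] at this
      by_contra hd
      have := Nat.le_of_dvd (by omega) this
      omega
    subst d0
    rw [h2, ← pow_succ'] at k4
    have k4' := orderOf_dvd_of_pow_eq_one k4
    rw [hzo] at k4'
    have k4'' := Nat.le_of_dvd (by omega) k4'
    have c3 : c = 3 := by omega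
    have k6' := k6 c3
    obtain ⟨y, hy⟩ := hex
    have k7 := k5 y
    rw [h2, ← pow_succ'] at k7
    have k7' := orderOf_dvd_of_pow_eq_one k7
    rw [hy] at k7'
    have k7'' := Nat.le_of_dvd (by omega) k7'
    have : 1 ≤ bd 0 0 := by
      simp only [bd]; split_ifs <;> simp [Nat.one_le_pow]
    have h5 : 5 ≤ (b+1)^r := le_trans hp (Nat.le_self_pow (by omega) _)
    have : 4 * e ≤ b * e := Nat.mul_le_mul_right _ (by omega)
    omega
  · intro χ hχ
    refine ⟨0, 0, 0, by simp, by simp, by simp [hT' χ hχ], by simp [hT χ hχ], by simp [hT χ hχ], ?_⟩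
    intro _
    simp only [bd]
    split_ifs <;> simp [Nat.one_le_pow]
  · rintro l hl χ j ⟨c, d, e, k1, k2, k3, k4, k5, k6⟩
    refine ⟨c, d, e, k1, k2, k3, k4, k5, fun hc => le_trans ?_ (k6 hc)⟩
    simp only [bd, pow_zero]
    have := hpp r
    refine Nat.add_le_add_left ?_ _
    split_ifs <;> omega
  · rintro l hl t ht χ j ⟨c, d, e, k1, k2, k3, k4, k5, k6⟩
    refine ⟨c, d, e, k1, k2, k3, k4, k5, fun hc => le_trans ?_ (k6 hc)⟩
    simp only [bd]
    have := Nat.pow_le_pow_right (n := b+1) (by omega) (Nat.le_succ t)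
    refine Nat.add_le_add_left ?_ _
    split_ifs <;> omega
  · rintro l hl t ht χ j ⟨c, d, e, k1, k2, k3, k4, k5, k6⟩
    by_cases hla : l = a
    · subst hla
      refine ⟨c+1, d, e + (b+1)^t, by omega, by omega, ?_, ?_, ?_, ?_⟩
      · simpa [he2] using k3
      · rw [map_mul, map_pow, map_inv, he3, inv_inv, fr] at k4
        rw [← k4, pow_succ']; simp only [mul_assoc]
      · intro y
        have := k5 y
        rw [map_mul, map_pow, map_inv, he3, inv_inv] at this
        rw [← this, pow_add, mul_comm (y^e), mul_assoc]
      · intro hc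
        have := k6 (by omega)
        simp only [bd, lt_irrefl, if_false, if_true] at this ⊢
        rw [pow_succ] at this
        linarith
    · refine ⟨c, d+1, e, by omega, by omega, ?_, ?_, ?_, by omega⟩
      · rw [map_mul, map_pow, map_inv, he1 l hl hla, inv_inv, fr] at k3
        rw [← k3, pow_succ']; simp only [mul_assoc]
      · simpa [he4 _ l hl hla] using k4
      · intro y
        simpa [he4 _ l hl hla] using k5 y
  · rintro l hl t ht χ j ⟨c, d, e, k1, k2, k3, k4, k5, k6⟩
    by_cases hla : l = a
    · subst hla
      refine ⟨c+1, d, e + (b+1)^(t+1), by omega, by omega, ?_, ?_, ?_, by omega⟩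
      · simpa [he2] using k3
      · rw [map_mul, map_pow, map_inv, he3, inv_inv, fr] at k4
        rw [← k4, pow_succ']; simp only [mul_assoc]
      · intro y
        have := k5 y
        rw [map_mul, map_pow, map_inv, he3, inv_inv] at this
        rw [← this, pow_add, mul_comm (y^e), mul_assoc]
    · refine ⟨c, d+1, e, by omega, by omega, ?_, ?_, ?_, by omega⟩
      · rw [map_mul, map_pow, map_inv, he1 l hl hla, inv_inv, fr] at k3
        rw [← k3, pow_succ']; simp only [mul_assoc]
      · simpa [he4 _ l hl hla] using k4
      · intro y
        simpa [he4 _ l hl hla] using k5 y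

end Sys
end GLC

namespace GLC

section
open Polynomial
variable {K Γ : Type} [Field K] [Group Γ]

/-- affine action -/
def affPerm {lam : ℕ → Γ →* Kˣ} {tau : ℕ → Γ → K} (hA : ∀ i, Aff (lam i) (tau i)) (l : ℕ) :
    Γ →* Equiv.Perm (Fin l → K) :=
  MonoidHom.toHomPerm
    { toFun := fun g x i => (lam i g : K) * x i + tau i g
      map_one' := by
        funext x i
        show (lam i 1 : K) * x i + tau i 1 = x i
        simp [(hA i).one]
      map_mul' := fun g h => by
        funext x i
        show (lam i (g * h) : K) * x i + tau i (g * h) =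
          (lam i g : K) * ((lam i h : K) * x i + tau i h) + tau i g
        simp only [(hA i).mul, map_mul, Units.val_mul]
        ring }

lemma affPerm_apply {lam : ℕ → Γ →* Kˣ} {tau : ℕ → Γ → K} (hA : ∀ i, Aff (lam i) (tau i)) (l : ℕ)
    (g : Γ) (x : Fin l → K) (i : Fin l) : affPerm hA l g x i = (lam i g : K) * x i + tau i g := rfl

lemma polyRep_one {l : Γ →* Kˣ} {t : Γ → K} (h : Aff l t) (g : Γ) (f : degreeLT K 1) :
    polyRep h 1 g f = f := by
  apply Subtype.ext
  rw [polyRep_coe]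
  have : f.1 = C (f.1.coeff 0) := by
    ext n
    rw [coeff_C]
    split_ifs with hn
    · rw [hn]
    · exact mem_dlt.1 f.2 n (by omega)
  rw [this, C_comp]

def eqvOne (K : Type) [Field K] : degreeLT K 1 ≃ₗ[K] K :=
  (degreeLTEquiv K 1).trans (LinearEquiv.funUnique (Fin 1) K K)

lemma bridge1 {lam : ℕ → Γ →* Kˣ} {tau : ℕ → Γ → K} (hA : ∀ i, Aff (lam i) (tau i)) (l : ℕ)
    (χ : Γ →* Kˣ) (j : ℕ) :
    cd (funRep (affPerm hA l) (twist χ (polyRep (hA l) 1))) j =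
      cd (funRep (affPerm hA l) (chi χ)) j := by
  refine cd_iso (LinearEquiv.piCongrRight (fun _ : (Fin l → K) => eqvOne K)) ?_ j
  intro g a
  ext x
  show eqvOne K ((χ g : K) • polyRep (hA l) 1 g _) = (χ g : K) * eqvOne K _
  rw [polyRep_one, map_smul]
  rfl

def evMap (K : Type) [Field K] (N l : ℕ) :
    ((Fin l → K) → degreeLT K N) →ₗ[K] ((Fin (l+1) → K) → K) where
  toFun f x := (f (fun i => x i.castSucc)).1.eval (x (Fin.last l))
  map_add' f f' := by funext x; exact eval_add
  map_smul' c f := by funext x; exact eval_smul ..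

lemma evMap_bij [Fintype K] (l : ℕ) : Function.Bijective (evMap K (Fintype.card K) l) := by
  classical
  constructor
  · intro f f' h
    funext x
    apply Subtype.ext
    refine eq_of_degrees_lt_of_eval_finset_eq (Finset.univ : Finset K)
      (mem_degreeLT.1 (f x).2) (mem_degreeLT.1 (f' x).2) ?_
    intro y _
    have := congrFun h (Fin.snoc x y : Fin (l+1) → K)
    simpa [evMap] using this
  · intro F
    refine ⟨fun x => ⟨Lagrange.interpolate Finset.univ id (fun y => F (Fin.snoc x y : Fin (l+1) → K)),
      ?_⟩, ?_⟩
    · rw [mem_degreeLT]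
      exact Lagrange.degree_interpolate_lt _ (Function.injective_id.injOn)
    · funext x
      have h1 := Lagrange.eval_interpolate_at_node (s := (Finset.univ : Finset K)) (v := id)
        (fun y => F (Fin.snoc (fun i => x i.castSucc) y : Fin (l+1) → K))
        (Function.injective_id.injOn) (Finset.mem_univ (x (Fin.last l)))
      show eval (x (Fin.last l)) _ = _
      refine h1.trans ?_
      congr 1
      exact Fin.snoc_init_self x

lemma bridge2 [Fintype K] {lam : ℕ → Γ →* Kˣ} {tau : ℕ → Γ → K} (hA : ∀ i, Aff (lam i) (tau i))
    (l : ℕ) (χ : Γ →* Kˣ) (j N : ℕ) (hN : N = Fintype.card K) :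
    cd (funRep (affPerm hA l) (twist χ (polyRep (hA l) N))) j =
      cd (funRep (affPerm hA (l+1)) (chi χ)) j := by
  subst hN
  refine cd_iso (LinearEquiv.ofBijective _ (evMap_bij l)) ?_ j
  intro g a
  ext x
  show eval (x (Fin.last l)) ((twist χ (polyRep (hA l) (Fintype.card K)) g
      (a (affPerm hA l g⁻¹ fun i => x i.castSucc))).1) =
    (χ g : K) * eval (affPerm hA (l+1) g⁻¹ x (Fin.last l))
      (a (fun i => affPerm hA (l+1) g⁻¹ x i.castSucc)).1
  rw [twist_apply, Submodule.coe_smul, polyRep_coe, eval_smul, eval_comp, smul_eq_mul]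
  simp only [affP, affPerm_apply, eval_add, eval_mul, eval_C, eval_X, Fin.val_last]
  rfl

lemma bridge0 (s : Γ →* Equiv.Perm (Fin 0 → K)) (χ : Γ →* Kˣ) (j : ℕ) :
    cd (funRep s (chi χ)) j = cd (chi χ) j := by
  refine cd_iso (LinearEquiv.funUnique (Fin 0 → K) K K) ?_ j
  intro g a
  simp [LinearEquiv.funUnique]
  congr 1
  exact Subsingleton.elim _ _

lemma prime_choose_a (p : ℕ) [hp : Fact p.Prime] : ∀ n < p - 1, ¬ p ∣ (n+1).choose 1 := by
  intro n hn h
  rw [Nat.choose_one_right] at h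
  have := Nat.le_of_dvd (by omega) h
  omega

lemma prime_choose_b (p : ℕ) [hp : Fact p.Prime] : ∀ n < 1, ¬ p ∣ (n+(p-1)).choose (p-1) := by
  intro n hn h
  obtain rfl : n = 0 := by omega
  rw [zero_add, Nat.choose_self] at h
  exact hp.out.one_lt.ne' (Nat.dvd_one.1 h)

lemma step_ineq (p : ℕ) [hp : Fact p.Prime] [CharP K p] {Ω : Type} (s : Γ →* Equiv.Perm Ω)
    {l : Γ →* Kˣ} {τ : Γ → K} (h : Aff l τ) (t : ℕ) (χ : Γ →* Kˣ) :
    let b : ℕ → (Γ →* Kˣ) → ℕ → ℕ∞ := fun t χ j => cd (funRep s (twist χ (polyRep h (p^t)))) j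
    b t χ 0 ≤ b (t+1) χ 0 ∧ b t χ 1 ≤ b (t+1) (χ * l⁻¹^(p^t)) 0 + b (t+1) χ 1 ∧
    ∀ j, b t χ (j+2) ≤ b t (χ * l⁻¹^(p^(t+1))) j + b (t+1) (χ * l⁻¹^(p^t)) (j+1) +
      b (t+1) χ (j+2) := by
  intro b
  have c1 := choose_ne p 1 (p-1) (prime_choose_a p) t
  have c2 := choose_ne p (p-1) 1 (prime_choose_b p) t
  simp only [one_mul] at c1 c2
  have e : p^t + (p-1)*p^t = p^(t+1) := by
    have := hp.out.one_lt
    obtain ⟨x, rfl⟩ : ∃ x, p = x + 1 := ⟨p-1, by omega⟩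
    simp only [Nat.add_sub_cancel]; ring
  have e' : (p-1)*p^t + p^t = p^(t+1) := by omega
  obtain ⟨f1, g1, s1⟩ := poly_ses h (p^t) ((p-1)*p^t) (fun n hn hc =>
    c1 n hn ((CharP.cast_eq_zero_iff K p _).1 hc))
  obtain ⟨f2, g2, s2⟩ := poly_ses h ((p-1)*p^t) (p^t) (fun n hn hc =>
    c2 n hn ((CharP.cast_eq_zero_iff K p _).1 hc))
  have s1' := (s1.twist χ).func s
  have s2' := (s2.twist (χ * l⁻¹^(p^t))).func s
  rw [twist_twist] at s1' s2'
  have e2 : χ * l⁻¹^(p^t) * l⁻¹^((p-1)*p^t) = χ * l⁻¹^(p^(t+1)) := by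
    ext g
    show ((χ g * (l g)⁻¹^(p^t) * (l g)⁻¹^((p-1)*p^t) : Kˣ) : K) =
      ((χ g * (l g)⁻¹^(p^(t+1)) : Kˣ) : K)
    rw [mul_assoc, ← pow_add, e]
  rw [e2] at s2'
  have b1 : ∀ χ j, b (t+1) χ j = cd (funRep s (twist χ (polyRep h (p^t + (p-1)*p^t)))) j := by
    intro χ j; rw [e]
  have b2 : ∀ χ j, b (t+1) χ j = cd (funRep s (twist χ (polyRep h ((p-1)*p^t + p^t)))) j := by
    intro χ j; rw [e']
  refine ⟨?_, ?_, ?_⟩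
  · rw [b1]; exact s1'.A0
  · refine (s1'.A1 0).trans (add_le_add ?_ (b1 _ _).ge)
    rw [b2]
    exact s2'.A0
  · intro j
    refine (s1'.A1 (j+1)).trans (add_le_add ?_ (b1 _ _).ge)
    rw [b2]
    exact s2'.A1 j

theorem exists_sys [Fintype K] [Finite Γ] (p r m : ℕ) [hp : Fact p.Prime] [CharP K p]
    (hq : Fintype.card K = p^r) {lam : ℕ → Γ →* Kˣ} {tau : ℕ → Γ → K}
    (hA : ∀ i, Aff (lam i) (tau i)) (tr : ∀ x : Fin m → K, ∃ g, ∀ i : Fin m, tau i g = x i)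
    (S : Subgroup Γ) (hS : ∀ g, g ∈ S ↔ ∀ i : Fin m, tau i g = 0) (hc : (Nat.card S : K) ≠ 0) :
    ∃ B, Sys m r p lam (fun χ => ∀ s ∈ S, χ s = 1) B ∧ ∀ χ j, B 0 0 χ j = cd (chi χ) j := by
  have sh : ∀ (χ : Γ →* Kˣ) j, cd (funRep (affPerm hA m) (chi χ)) j = cd (rs S.subtype (chi χ)) j := by
    intro χ j
    refine shapiro _ _ 0 ?_ S ?_ j
    · intro ω
      obtain ⟨g, hg⟩ := tr ω
      refine ⟨g, ?_⟩
      funext i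
      simp [affPerm_apply, hg]
    · intro g
      rw [hS, funext_iff]
      simp [affPerm_apply]
  refine ⟨fun l t χ j => cd (funRep (affPerm hA l) (twist χ (polyRep (hA l) (p^t)))) j,
    ⟨?_, ?_, ?_, ?_, ?_, ?_, ?_⟩, ?_⟩
  · intro l _ t _ χ
    exact (step_ineq p (affPerm hA l) (hA l) t χ).1
  · intro l _ t _ χ
    exact (step_ineq p (affPerm hA l) (hA l) t χ).2.1
  · intro l _ t _ χ j
    exact (step_ineq p (affPerm hA l) (hA l) t χ).2.2 j
  · intro l _ χ j
    rw [bridge2 hA l χ j _ hq.symm, pow_zero, bridge1]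
  · intro χ j
    rw [pow_zero, bridge1, sh]
    exact cd_prime_to_p _ hc j
  · intro χ
    rw [pow_zero, bridge1, sh]
    refine (cd_H0_le _).trans ?_
    rw [Module.length_eq_one_iff.2 inferInstance]
  · intro χ h s hs
    rw [pow_zero, bridge1, sh] at h
    by_contra hne
    apply h
    rw [cd_H0_zero]
    intro a ha
    have h1 := ha ⟨s, hs⟩
    simp only [rs_apply, chi_apply, Subgroup.subtype_apply] at h1
    by_contra ha0
    apply hne
    ext
    exact mul_right_cancel₀ ha0 (by simpa using h1)
  · intro χ j
    show cd (funRep (affPerm hA 0) (twist χ (polyRep (hA 0) (p^0)))) j = _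
    rw [pow_zero, bridge1, bridge0]

end
end GLC

namespace GLC
open Matrix

/-- the maximal parabolic subgroup, as an abstract group -/
@[ext] structure PQ (F : Type) [Field F] (m : ℕ) where
  a : Fˣ
  v : Fin m → F
  h : GL (Fin m) F

namespace PQ
variable {F : Type} [Field F] {m : ℕ}

instance : Mul (PQ F m) := ⟨fun x y => ⟨x.a * y.a, (x.a : F) • y.v + x.v ᵥ* y.h.1, x.h * y.h⟩⟩
instance : One (PQ F m) := ⟨⟨1, 0, 1⟩⟩
instance : Inv (PQ F m) := ⟨fun x => ⟨x.a⁻¹, -((x.a⁻¹ : Fˣ) : F) • (x.v ᵥ* (x.h⁻¹).1), x.h⁻¹⟩⟩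

@[simp] lemma mul_a (x y : PQ F m) : (x * y).a = x.a * y.a := rfl
@[simp] lemma mul_h (x y : PQ F m) : (x * y).h = x.h * y.h := rfl
lemma mul_v (x y : PQ F m) : (x * y).v = (x.a : F) • y.v + x.v ᵥ* y.h.1 := rfl
@[simp] lemma one_a : (1 : PQ F m).a = 1 := rfl
@[simp] lemma one_h : (1 : PQ F m).h = 1 := rfl
@[simp] lemma one_v : (1 : PQ F m).v = 0 := rfl
@[simp] lemma inv_a (x : PQ F m) : (x⁻¹).a = x.a⁻¹ := rfl
@[simp] lemma inv_h (x : PQ F m) : (x⁻¹).h = x.h⁻¹ := rfl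
lemma inv_v (x : PQ F m) : (x⁻¹).v = -((x.a⁻¹ : Fˣ) : F) • (x.v ᵥ* (x.h⁻¹).1) := rfl

instance : Group (PQ F m) :=
  Group.ofLeftAxioms
    (fun x y z => by
      ext : 1
      · simp [mul_assoc]
      · simp only [mul_v, mul_a, mul_h, Units.val_mul, Matrix.add_vecMul, Matrix.vecMul_vecMul,
          Matrix.smul_vecMul, smul_add, smul_smul, add_assoc]
      · simp [mul_assoc])
    (fun x => by
      ext : 1
      · simp
      · simp [mul_v]
      · simp)
    (fun x => by
      ext : 1
      · simp
      · simp only [mul_v, inv_v, inv_a, Matrix.smul_vecMul, Matrix.vecMul_vecMul, one_v]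
        rw [← Units.val_mul, inv_mul_cancel]
        simp
      · simp)

instance [Finite F] : Finite (PQ F m) := by
  have : Function.Injective (fun x : PQ F m => (x.a, x.v, x.h)) := by
    intro x y h
    simp only [Prod.mk.injEq] at h
    exact PQ.ext h.1 h.2.1 h.2.2
  exact Finite.of_injective _ this

variable (F m) in
def aH : PQ F m →* Fˣ := { toFun := PQ.a, map_one' := rfl, map_mul' := fun _ _ => rfl }
variable (F m) in
def hH : PQ F m →* GL (Fin m) F := { toFun := PQ.h, map_one' := rfl, map_mul' := fun _ _ => rfl }

@[simp] lemma aH_apply (x : PQ F m) : aH F m x = x.a := rfl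
@[simp] lemma hH_apply (x : PQ F m) : hH F m x = x.h := rfl

/-- block matrix -/
def mat (x : PQ F m) : Matrix (Fin (m+1)) (Fin (m+1)) F :=
  Matrix.of (Fin.cons (Fin.cons (x.a : F) x.v) (fun j => Fin.cons 0 (x.h.1 j)))

@[simp] lemma mat00 (x : PQ F m) : x.mat 0 0 = x.a := rfl
@[simp] lemma mat0s (x : PQ F m) (i : Fin m) : x.mat 0 i.succ = x.v i := rfl
@[simp] lemma mats0 (x : PQ F m) (i : Fin m) : x.mat i.succ 0 = 0 := rfl
@[simp] lemma matss (x : PQ F m) (i j : Fin m) : x.mat i.succ j.succ = x.h.1 i j := rfl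

lemma mat_one : (1 : PQ F m).mat = 1 := by
  ext i j
  refine Fin.cases ?_ (fun i => ?_) i <;> refine Fin.cases ?_ (fun j => ?_) j <;>
    simp [Matrix.one_apply, Fin.succ_ne_zero, (Fin.succ_ne_zero _).symm]

lemma mat_mul (x y : PQ F m) : (x * y).mat = x.mat * y.mat := by
  ext i j
  refine Fin.cases ?_ (fun i => ?_) i <;> refine Fin.cases ?_ (fun j => ?_) j <;>
    simp [Matrix.mul_apply, Fin.sum_univ_succ, mul_v, Matrix.vecMul, dotProduct]

variable (F m) in
def iota : PQ F m →* GL (Fin (m+1)) F :=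
  MonoidHom.toHomUnits { toFun := mat, map_one' := mat_one, map_mul' := mat_mul }

@[simp] lemma iota_coe (x : PQ F m) : (iota F m x).1 = x.mat := rfl

lemma iota_inj : Function.Injective (iota F m) := by
  intro x y hxy
  have h : x.mat = y.mat := congrArg Units.val hxy
  ext : 1
  · ext; exact congrFun (congrFun h 0) 0
  · funext i; exact congrFun (congrFun h 0) i.succ
  · ext i j; exact congrFun (congrFun h i.succ) j.succ

lemma mem_range_iota (g : GL (Fin (m+1)) F) (hg : ∀ i : Fin m, g.1 i.succ 0 = 0) (h0 : g.1 0 0 = 1) :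
    g ∈ (iota F m).range := by
  have hg' : g⁻¹.1 *ᵥ (Pi.single 0 1) = Pi.single 0 1 := by
    have h1 : g.1 *ᵥ (Pi.single 0 1) = Pi.single 0 1 := by
      ext i
      rw [Matrix.mulVec_single_one]
      refine Fin.cases ?_ (fun i => ?_) i
      · simpa using h0
      · simpa using hg i
    conv_lhs => rw [← h1]
    rw [Matrix.mulVec_mulVec, ← Units.val_mul, inv_mul_cancel, Units.val_one, Matrix.one_mulVec]
  have hi : ∀ i : Fin m, g⁻¹.1 i.succ 0 = 0 := by
    intro i
    have := congrFun hg' i.succ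
    rw [Matrix.mulVec_single_one] at this
    simpa using this
  have key : ∀ x y : GL (Fin (m+1)) F, (∀ i : Fin m, y.1 i.succ 0 = 0) → (∀ i : Fin m, x.1 i.succ 0 = 0) →
      x * y = 1 →
      (Matrix.of fun i j : Fin m => x.1 i.succ j.succ : Matrix (Fin m) (Fin m) F) *
      (Matrix.of fun i j : Fin m => y.1 i.succ j.succ : Matrix (Fin m) (Fin m) F) = 1 := by
    intro x y hy hx hxy
    ext i j
    have h0 : (x * y).1 = (1 : GL (Fin (m+1)) F).1 := by rw [hxy]
    have h1 : (x * y).1 i.succ j.succ = (1 : GL (Fin (m+1)) F).1 i.succ j.succ := by rw [h0]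
    rw [Units.val_mul, Matrix.mul_apply, Fin.sum_univ_succ, hx, zero_mul, zero_add] at h1
    rw [Matrix.mul_apply]
    refine h1.trans ?_
    rw [Units.val_one, Matrix.one_apply, Matrix.one_apply]
    simp only [Fin.succ_inj]
  refine ⟨⟨1, fun i => g.1 0 i.succ, ⟨Matrix.of fun i j => g.1 i.succ j.succ,
    Matrix.of fun i j => g⁻¹.1 i.succ j.succ, key g g⁻¹ hi hg (by simp), key g⁻¹ g hg hi (by simp)⟩⟩, ?_⟩
  ext i j
  refine Fin.cases ?_ (fun i => ?_) i <;> refine Fin.cases ?_ (fun j => ?_) j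
  · simp [h0]
  · simp
  · simp [hg]
  · simp

end PQ

/-- transitivity on nonzero vectors -/
lemma exists_gl {F ι : Type} [Field F] [Fintype ι] [DecidableEq ι] (x y : ι → F) (hx : x ≠ 0) (hy : y ≠ 0) :
    ∃ g : GL ι F, g.1 *ᵥ x = y := by
  let f := (LinearEquiv.toSpanNonzeroSingleton F (ι → F) x hx).symm.trans
    (LinearEquiv.toSpanNonzeroSingleton F (ι → F) y hy)
  obtain ⟨e, he⟩ := Submodule.exists_linearEquiv_restrict_eq f
  have hex : e x = y := by
    have h1 := he ⟨x, Submodule.mem_span_singleton_self x⟩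
    have h2 : (LinearEquiv.toSpanNonzeroSingleton F (ι → F) x hx).symm
        ⟨x, Submodule.mem_span_singleton_self x⟩ = 1 := by
      rw [LinearEquiv.symm_apply_eq]
      apply Subtype.ext
      simp
    rw [← h1]
    simp only [f, LinearEquiv.trans_apply, h2]
    simp
  refine ⟨⟨LinearMap.toMatrix' (e : (ι → F) →ₗ[F] (ι → F)),
    LinearMap.toMatrix' (e.symm : (ι → F) →ₗ[F] (ι → F)), ?_, ?_⟩, ?_⟩
  · rw [← LinearMap.toMatrix'_comp]; simp
  · rw [← LinearMap.toMatrix'_comp]; simp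
  · rw [LinearMap.toMatrix'_mulVec]; exact hex

def Vec (F : Type) (n : ℕ) := Fin n → F

instance vecAct (F : Type) [Field F] (n : ℕ) : MulAction (GL (Fin n) F) (Vec F n) where
  smul g x := g.1 *ᵥ x
  one_smul x := Matrix.one_mulVec x
  mul_smul g h x := (Matrix.mulVec_mulVec x g.1 h.1).symm

lemma index_ne {F : Type} [Field F] [Fintype F] (m : ℕ) :
    (((PQ.iota F m).range).index : F) ≠ 0 := by
  classical
  let e0 : Vec F (m+1) := (Pi.single 0 1 : Fin (m+1) → F)
  let z0 : Vec F (m+1) := (0 : Fin (m+1) → F)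
  haveI : Fintype (Vec F (m+1)) := inferInstanceAs (Fintype (Fin (m+1) → F))
  have hcard : Fintype.card (Vec F (m+1)) = Fintype.card F ^ (m+1) := by
    have := Fintype.card_fun (α := Fin (m+1)) (β := F)
    rw [Fintype.card_fin] at this
    rw [← this]
    exact Fintype.card_congr (Equiv.refl _)
  have he0 : e0 ≠ z0 := by
    intro h; simpa [e0, z0] using congrFun h 0
  have h1 : MulAction.stabilizer (GL (Fin (m+1)) F) e0 ≤ (PQ.iota F m).range := by
    intro g hg
    have hg' : g.1 *ᵥ (Pi.single 0 1) = Pi.single 0 1 := hg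
    rw [Matrix.mulVec_single_one] at hg'
    refine PQ.mem_range_iota g ?_ ?_
    · intro i
      have := congrFun hg' i.succ
      simpa using this
    · have := congrFun hg' 0
      simpa using this
  have h2 := Subgroup.index_dvd_of_le h1
  rw [MulAction.index_stabilizer] at h2
  have h3 : MulAction.orbit (GL (Fin (m+1)) F) e0 = {z0}ᶜ := by
    ext w
    simp only [Set.mem_compl_iff, Set.mem_singleton_iff]
    constructor
    · rintro ⟨g, rfl⟩ h0
      have h0' : g • e0 = z0 := h0
      apply he0
      rw [← inv_smul_smul g e0, h0']
      exact Matrix.mulVec_zero _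
    · intro hw
      obtain ⟨g, hg⟩ := exists_gl e0 w he0 hw
      exact ⟨g, hg⟩
  rw [h3, Set.ncard_compl, Set.ncard_singleton, Nat.card_eq_fintype_card, hcard] at h2
  intro hc
  obtain ⟨c, hc'⟩ := h2
  have h4 : ((Fintype.card F ^ (m+1) - 1 : ℕ) : F) = 0 := by
    rw [hc']; push_cast; rw [hc, zero_mul]
  rw [Nat.cast_sub (Nat.one_le_pow _ _ Fintype.card_pos)] at h4
  simp at h4

/-- restriction to the parabolic -/
lemma cd_le_PQ {F M : Type} [Field F] [Fintype F] [AddCommGroup M] [Module F M] (m : ℕ)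
    (ρ : Representation F (GL (Fin (m+1)) F) M) (j : ℕ) : cd ρ j ≤ cd (rs (PQ.iota F m) ρ) j := by
  refine (transfer _ ρ (index_ne m) j).trans ?_
  rw [← cd_groupIso (MonoidHom.ofInjective (PQ.iota_inj (F := F) (m := m)))]
  exact le_of_eq rfl

end GLC

namespace GLC
open Matrix

section
variable (F : Type) [Field F] (m : ℕ)

def RR : Subgroup (PQ F m) := (PQ.hH F m).ker
instance : (RR F m).Normal := inferInstanceAs (PQ.hH F m).ker.Normal

variable {F m} in
lemma mem_RR (x : PQ F m) : x ∈ RR F m ↔ x.h = 1 := Iff.rfl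

def aR : RR F m →* Fˣ := (PQ.aH F m).comp (RR F m).subtype

def kap : Fˣ →* RR F m where
  toFun a := ⟨⟨a, 0, 1⟩, rfl⟩
  map_one' := rfl
  map_mul' a b := by
    apply Subtype.ext
    ext : 1
    · rfl
    · simp [PQ.mul_v]
    · simp

def SR : Subgroup (RR F m) := (kap F m).range

variable {F m} in
lemma mem_SR (x : RR F m) : x ∈ SR F m ↔ x.1.v = 0 := by
  constructor
  · rintro ⟨a, rfl⟩; rfl
  · intro h
    refine ⟨x.1.a, Subtype.ext (PQ.ext rfl h.symm ?_)⟩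
    exact x.2.symm

lemma card_units [Fintype F] : (Nat.card Fˣ : F) ≠ 0 := by
  classical
  rw [Nat.card_eq_fintype_card, Fintype.card_units, Nat.cast_sub Fintype.card_pos]
  simp

lemma card_SR [Fintype F] : (Nat.card (SR F m) : F) ≠ 0 := by
  have : Nat.card (SR F m) = Nat.card Fˣ := by
    refine (Nat.card_congr (MonoidHom.ofInjective (f := kap F m) ?_).toEquiv).symm
    intro x y h
    exact congrArg (fun z : RR F m => z.1.a) h
  rw [this]
  exact card_units F

def tauR (i : ℕ) (g : RR F m) : F := if h : i < m then g.1.v ⟨i, h⟩ else 0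

lemma affR (i : ℕ) : Aff (aR F m) (tauR F m i) := by
  constructor
  intro g h
  simp only [tauR]
  split_ifs with hi
  · have : h.1.h = 1 := h.2
    simp [PQ.mul_v, this, aR]
  · simp

variable [Fintype F] (p r : ℕ) [hp : Fact p.Prime] [CharP F p] (hq : Fintype.card F = p^r)

include hq in
lemma exists_sysR : ∃ B, Sys m r p (fun _ => aR F m) (fun χ => ∀ s ∈ SR F m, χ s = 1) B ∧
    ∀ χ j, B 0 0 χ j = cd (chi χ) j := by
  refine exists_sys p r m hq (affR F m) ?_ (SR F m) ?_ (card_SR F m)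
  · intro x
    refine ⟨⟨⟨1, x, 1⟩, rfl⟩, ?_⟩
    intro i
    simp [tauR]
  · intro g
    rw [mem_SR, funext_iff]
    simp [tauR]

include hq in
lemma exists_gen : ∃ y : Fˣ, orderOf y = p^r - 1 := by
  classical
  obtain ⟨y, hy⟩ := IsCyclic.exists_generator (α := Fˣ)
  refine ⟨y, ?_⟩
  rw [orderOf_eq_card_of_forall_mem_zpowers hy, Nat.card_eq_fintype_card, Fintype.card_units, hq]

include hq in
lemma r_pos : 0 < r := by
  rcases Nat.eq_zero_or_pos r with h | h
  · subst h
    have := Fintype.one_lt_card (α := F)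
    rw [hq, pow_zero] at this
    omega
  · exact h

include hq in
lemma exists_zeta : ∃ z : Fˣ, orderOf z = p - 1 ∧ z^p = z := by
  obtain ⟨y, hy⟩ := exists_gen F p r hq
  have hr := r_pos F p r hq
  have h1 := hp.out.one_lt
  have h2 : p - 1 ∣ p^r - 1 := by simpa using Nat.sub_dvd_pow_sub_pow p 1 r
  have h3 : 1 < p^r := Nat.one_lt_pow (by omega) h1
  obtain ⟨c, hc⟩ := h2
  have hc0 : c ≠ 0 := by rintro rfl; omega
  have ho : orderOf (y^c) = p - 1 := by
    rw [orderOf_pow_of_dvd hc0 (by rw [hy, hc]; exact dvd_mul_left _ _), hy, hc]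
    exact Nat.mul_div_cancel _ (Nat.pos_of_ne_zero hc0)
  refine ⟨y^c, ho, ?_⟩
  have : p = (p - 1) + 1 := by omega
  conv_lhs => rw [this]
  rw [pow_succ, ← ho, pow_orderOf_eq_one, one_mul]

include hq in
lemma R_facts (hp5 : 5 ≤ p) :
    (∀ j, 1 ≤ j → j ≤ 3 → cd (chi (1 : RR F m →* Fˣ)) j = 0) ∧
    (cd (chi (aR F m)) 0 = 0 ∧ cd (chi (aR F m)) 3 = 0 ∧ cd (chi (aR F m)) 1 ≤ m ∧
      cd (chi (aR F m)) 2 ≤ m) ∧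
    (∀ j ≤ 2, cd (chi (aR F m)⁻¹) j = 0) := by
  obtain ⟨B, hB, hcd⟩ := exists_sysR F m p r hq
  obtain ⟨z, hz, hzp⟩ := exists_zeta F p r hq
  have hzn : ∀ n, 0 < n → n < 4 → z^n ≠ 1 := by
    intro n h1 h2 h3
    have := Nat.le_of_dvd h1 (orderOf_dvd_of_pow_eq_one h3)
    omega
  let ev : (RR F m →* Fˣ) →* Fˣ := MonoidHom.eval (kap F m z)
  have eva : ev (aR F m) = z := rfl
  have hv1 := hB.van1 ev z hzp (fun l _ => rfl) (fun χ h => h _ ⟨z, rfl⟩)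
  have van : ∀ χ j, (∀ i, j ≤ 2*i → i ≤ j → ev χ ≠ z^i) → cd (chi χ) j = 0 := by
    intro χ j h
    by_contra hc
    rw [← hcd] at hc
    obtain ⟨i, h1, h2, h3⟩ := hv1.1 0 (Nat.zero_le _) χ j hc
    exact h i h1 h2 h3
  refine ⟨?_, ⟨?_, ?_, ?_⟩, ?_⟩
  · intro j h1 h3
    refine van _ _ fun i k1 k2 k3 => ?_
    rw [map_one] at k3
    exact hzn i (by omega) (by omega) k3.symm
  · refine van _ _ fun i k1 k2 k3 => ?_
    obtain rfl : i = 0 := by omega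
    rw [eva, pow_zero] at k3
    exact hzn 1 (by omega) (by omega) (by simpa using k3)
  · refine van _ _ fun i k1 k2 k3 => ?_
    obtain ⟨i', rfl⟩ : ∃ i', i = i' + 1 := ⟨i-1, by omega⟩
    rw [eva, pow_succ] at k3
    exact hzn i' (by omega) (by omega) (by simpa using k3.symm)
  · rw [← hcd, ← hcd]
    refine hB.counts (r_pos F p r hq) hp.out.two_le (aR F m) (fun _ _ => rfl) ?_ ?_
    · intro e he
      obtain ⟨y, hy⟩ := exists_gen F p r hq
      have h1 : y * y⁻¹^e = 1 := he (kap F m y) ⟨y, rfl⟩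
      have h2 : y ^ ((e:ℤ) - 1) = 1 := by
        rw [inv_pow, mul_inv_eq_one] at h1
        rw [_root_.zpow_sub_one, zpow_natCast, ← h1, mul_inv_cancel]
      have h3 := orderOf_dvd_iff_zpow_eq_one.2 h2
      rw [hy, Nat.cast_sub (Nat.one_le_pow _ _ hp.out.pos)] at h3
      simpa using h3
    · intro t ht l hl
      by_contra hc
      obtain ⟨i, h1, h2, h3⟩ := hv1.2 l hl (t+1) ht _ 1 hc
      obtain rfl : i = 1 := by omega
      have e1 : ev (aR F m * (aR F m)⁻¹^(p^t)) = z * z⁻¹^(p^t) := rfl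
      rw [e1, inv_pow, hB.zpow_frob hzp, mul_inv_cancel] at h3
      exact hzn 1 (by omega) (by omega) h3.symm
  · intro j hj
    refine van _ _ fun i k1 k2 k3 => ?_
    have e2 : ev (aR F m)⁻¹ = z⁻¹ := rfl
    rw [e2, inv_eq_iff_mul_eq_one, ← pow_succ'] at k3
    exact hzn (i+1) (by omega) (by omega) k3

end

section
variable (F : Type) [Field F] (m : ℕ)

def dg : (Fin m → Fˣ) →* GL (Fin m) F :=
  MonoidHom.toHomUnits
    { toFun := fun d => Matrix.diagonal (fun i => (d i : F))
      map_one' := by simp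
      map_mul' := fun d d' => by simp }

lemma dg_coe (d : Fin m → Fˣ) : (dg F m d).1 = Matrix.diagonal (fun i => (d i : F)) := rfl

lemma dg_inj : Function.Injective (dg F m) := by
  intro d d' h
  have h1 : (dg F m d).1 = (dg F m d').1 := by rw [h]
  rw [dg_coe, dg_coe] at h1
  have h2 := Matrix.diagonal_injective h1
  funext i
  ext
  exact congrFun h2 i

def KK : Subgroup (PQ F m) := (dg F m).range.comap (PQ.hH F m)

lemma RR_le_KK : RR F m ≤ KK F m := by
  intro x hx
  refine ⟨1, ?_⟩
  rw [map_one]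
  exact hx.symm

def dK : KK F m →* (Fin m → Fˣ) :=
  ((MonoidHom.ofInjective (dg_inj F m)).symm.toMonoidHom).comp
    ((PQ.hH F m).subgroupComap (dg F m).range)

variable {F m} in
lemma dK_spec (x : KK F m) : dg F m (dK F m x) = x.1.h := by
  have := (MonoidHom.ofInjective (dg_inj F m)).apply_symm_apply
    ((PQ.hH F m).subgroupComap (dg F m).range x)
  exact congrArg Subtype.val this

def aK : KK F m →* Fˣ := (PQ.aH F m).comp (KK F m).subtype
def dKi (i : Fin m) : KK F m →* Fˣ := (Pi.evalMonoidHom _ i).comp (dK F m)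

def kapK : Fˣ × (Fin m → Fˣ) →* KK F m where
  toFun x := ⟨⟨x.1, 0, dg F m x.2⟩, ⟨x.2, rfl⟩⟩
  map_one' := by
    apply Subtype.ext
    ext : 1
    · rfl
    · rfl
    · exact map_one (dg F m)
  map_mul' a b := by
    apply Subtype.ext
    ext : 1
    · rfl
    · simp [PQ.mul_v]
    · exact map_mul (dg F m) _ _

def SK : Subgroup (KK F m) := (kapK F m).range

variable {F m} in
lemma dK_kap (x : Fˣ × (Fin m → Fˣ)) : dK F m (kapK F m x) = x.2 :=
  dg_inj F m (dK_spec _)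

variable {F m} in
lemma mem_SK (x : KK F m) : x ∈ SK F m ↔ x.1.v = 0 := by
  constructor
  · rintro ⟨a, rfl⟩; rfl
  · intro h
    refine ⟨(x.1.a, dK F m x), Subtype.ext (PQ.ext rfl h.symm (dK_spec x))⟩

lemma card_SK [Fintype F] : (Nat.card (SK F m) : F) ≠ 0 := by
  have : Nat.card (SK F m) = Nat.card (Fˣ × (Fin m → Fˣ)) := by
    refine (Nat.card_congr (MonoidHom.ofInjective (f := kapK F m) ?_).toEquiv).symm
    intro x y h
    refine Prod.ext (congrArg (fun z : KK F m => z.1.a) h) ?_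
    rw [← dK_kap x, h, dK_kap]
  rw [this, Nat.card_prod, Nat.card_fun]
  push_cast
  exact mul_ne_zero (card_units F) (pow_ne_zero _ (card_units F))

def lamK (i : ℕ) : KK F m →* Fˣ := if h : i < m then aK F m * (dKi F m ⟨i, h⟩)⁻¹ else 1
def tauK (i : ℕ) (g : KK F m) : F :=
  if h : i < m then (((dK F m g ⟨i, h⟩)⁻¹ : Fˣ) : F) * g.1.v ⟨i, h⟩ else 0

lemma affK (i : ℕ) : Aff (lamK F m i) (tauK F m i) := by
  constructor
  intro g h
  simp only [tauK, lamK]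
  split_ifs with hi
  · have e : h.1.h.1 = Matrix.diagonal (fun i => (dK F m h i : F)) := by
      rw [← dK_spec h]; rfl
    simp only [Subgroup.coe_mul, PQ.mul_v, e, map_mul, Pi.mul_apply, Pi.add_apply, Pi.smul_apply,
      Matrix.vecMul_diagonal, smul_eq_mul, mul_inv, Units.val_mul]
    show _ = ((g.1.a * (dK F m g ⟨i, hi⟩)⁻¹ : Fˣ) : F) * _ + _
    rw [Units.val_mul]
    have := Units.inv_mul (dK F m h ⟨i, hi⟩)
    linear_combination (g.1.v ⟨i, hi⟩ * ((dK F m g ⟨i, hi⟩)⁻¹ : Fˣ)) * this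
  · simp

variable [Fintype F] (p r : ℕ) [hp : Fact p.Prime] [CharP F p] (hq : Fintype.card F = p^r)
include hq

lemma exists_sysK : ∃ B, Sys m r p (lamK F m) (fun χ => ∀ s ∈ SK F m, χ s = 1) B ∧
    ∀ χ j, B 0 0 χ j = cd (chi χ) j := by
  refine exists_sys p r m hq (affK F m) ?_ (SK F m) ?_ (card_SK F m)
  · intro x
    refine ⟨⟨⟨1, x, 1⟩, ⟨1, map_one _⟩⟩, ?_⟩
    intro i
    have : dK F m ⟨⟨1, x, 1⟩, ⟨1, map_one _⟩⟩ = 1 := dg_inj F m (by rw [dK_spec, map_one])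
    simp [tauK, this]
  · intro g
    rw [mem_SK, funext_iff]
    simp [tauK]

lemma K_facts (hp5 : 5 ≤ p) (i : Fin m) : cd (chi ((aK F m)⁻¹ * dKi F m i)) 3 = 0 := by
  classical
  obtain ⟨B, hB, hcd⟩ := exists_sysK F m p r hq
  obtain ⟨z, hz, hzp⟩ := exists_zeta F p r hq
  rw [← hcd]
  let s' : KK F m := kapK F m (1, fun l => if l = i then 1 else z)
  let s : Fˣ → KK F m := fun y => kapK F m (1, fun l => if l = i then y else 1)
  have ea : ∀ x, aK F m (kapK F m x) = x.1 := fun x => rfl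
  have ed : ∀ x l, dKi F m l (kapK F m x) = x.2 l := fun x l => congrFun (dK_kap x) l
  have el : ∀ x (l : ℕ) (hl : l < m), lamK F m l (kapK F m x) = x.1 * (x.2 ⟨l, hl⟩)⁻¹ := by
    intro x l hl
    simp only [lamK, dif_pos hl]
    exact congrArg₂ (fun a b : Fˣ => a * b⁻¹) (ea x) (ed x ⟨l, hl⟩)
  refine hB.van3 (r_pos F p r hq) hp5 (MonoidHom.eval s') (fun y => MonoidHom.eval (s y)) z hzp hz
    (exists_gen F p r hq) i ?_ ?_ ?_ ?_ ?_ ?_ _ ?_ ?_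
  · intro l hl hli
    refine (el _ l hl).trans ?_
    have hne : (⟨l, hl⟩ : Fin m) ≠ i := fun h => hli (congrArg Fin.val h)
    dsimp only
    rw [if_neg hne, one_mul]
  · refine (el _ i i.2).trans ?_
    simp
  · intro y
    refine (el _ i i.2).trans ?_
    simp
  · intro y l hl hli
    refine (el _ l hl).trans ?_
    have hne : (⟨l, hl⟩ : Fin m) ≠ i := fun h => hli (congrArg Fin.val h)
    dsimp only
    rw [if_neg hne]
    simp
  · intro χ h
    exact h _ ⟨_, rfl⟩
  · intro χ h y
    exact h _ ⟨_, rfl⟩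
  · show (aK F m s')⁻¹ * dKi F m i s' = 1
    rw [ea, ed]; simp
  · intro y
    show (aK F m (s y))⁻¹ * dKi F m i (s y) = y
    rw [ea, ed]; simp

end
end GLC

namespace GLC
open Matrix

section
variable (F : Type) [Field F] (m : ℕ)

/-- the quotient rep -/
def WW : Representation F (PQ F m) (Fin m → F) where
  toFun g := g.h.1.mulVecLin
  map_one' := by simp; rfl
  map_mul' g h := by simp [Matrix.mulVecLin_mul]; rfl

/-- the standard rep restricted to the parabolic -/
def VV : Representation F (PQ F m) (F × (Fin m → F)) where
  toFun g :=
    { toFun := fun x => ((g.a : F) * x.1 + g.v ⬝ᵥ x.2, g.h.1 *ᵥ x.2)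
      map_add' := fun x y => by
        ext : 1
        · simp [mul_add, dotProduct_add]; ring
        · simp [Matrix.mulVec_add]
      map_smul' := fun c x => by
        ext : 1
        · simp [mul_add, dotProduct_smul]; ring
        · simp [Matrix.mulVec_smul] }
  map_one' := by
    refine LinearMap.ext fun x => ?_
    ext : 1 <;> simp
  map_mul' g h := by
    refine LinearMap.ext fun x => ?_
    ext : 1
    · simp [PQ.mul_v, add_dotProduct, Matrix.dotProduct_mulVec]
      ring
    · simp

variable {F m}
@[simp] lemma WW_apply (g : PQ F m) (w : Fin m → F) : WW F m g w = g.h.1 *ᵥ w := rfl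
@[simp] lemma VV_apply (g : PQ F m) (x : F × (Fin m → F)) :
    VV F m g x = ((g.a : F) * x.1 + g.v ⬝ᵥ x.2, g.h.1 *ᵥ x.2) := rfl

lemma V_ses : SES (chi (PQ.aH F m)) (VV F m) (WW F m) (LinearMap.inl F F (Fin m → F))
    (LinearMap.snd F F (Fin m → F)) := by
  refine ⟨?_, ?_, LinearMap.inl_injective, LinearMap.snd_surjective, ?_⟩
  · intro g a; simp
  · intro g a; simp
  · intro b
    constructor
    · intro h; exact ⟨b.1, Prod.ext rfl h.symm⟩
    · rintro ⟨a, rfl⟩; rfl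

section
variable {Y Z X : Type} [AddCommGroup Y] [Module F Y] [AddCommGroup Z] [Module F Z]
  [AddCommGroup X] [Module F X]

/-- Hom(W, Y) -/
def homW (ρ : Representation F (PQ F m) Y) : Representation F (PQ F m) (Fin m → Y) where
  toFun g :=
    { toFun := fun f i => ∑ j, (g.h⁻¹).1 j i • ρ g (f j)
      map_add' := fun f f' => by ext i; simp [Finset.sum_add_distrib]
      map_smul' := fun c f => by
        ext i
        simp only [Pi.smul_apply, map_smul, Finset.smul_sum, RingHom.id_apply]
        exact Finset.sum_congr rfl fun j _ => smul_comm _ _ _ }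
  map_one' := by
    refine LinearMap.ext fun f => ?_
    ext i
    simp [Matrix.one_apply]
  map_mul' g h := by
    refine LinearMap.ext fun f => ?_
    ext i
    simp only [PQ.mul_h, _root_.mul_inv_rev, Units.val_mul, Matrix.mul_apply, Finset.sum_smul, map_mul,
      LinearMap.coe_mk, AddHom.coe_mk, Module.End.mul_apply, map_sum, map_smul, Finset.smul_sum,
      smul_smul]
    refine Eq.trans ?_ Finset.sum_comm
    refine Finset.sum_congr rfl fun j _ => Finset.sum_congr rfl fun l _ => ?_
    rw [mul_comm]

lemma homW_apply (ρ : Representation F (PQ F m) Y) (g : PQ F m) (f : Fin m → Y) (i : Fin m) :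
    homW ρ g f i = ∑ j, (g.h⁻¹).1 j i • ρ g (f j) := rfl

lemma Eqv.homW {ρ : Representation F (PQ F m) Y} {σ : Representation F (PQ F m) Z} {f : Y →ₗ[F] Z}
    (h : Eqv ρ σ f) : Eqv (homW ρ) (homW σ) (f.compLeft (Fin m)) := by
  intro g a
  ext i
  simp only [LinearMap.compLeft_apply, Function.comp_apply, homW_apply, map_sum, map_smul, h g _]

lemma SES.homW {ρ : Representation F (PQ F m) Y} {σ : Representation F (PQ F m) Z}
    {τ : Representation F (PQ F m) X} {f : Y →ₗ[F] Z} {g : Z →ₗ[F] X} (h : SES ρ σ τ f g) :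
    SES (homW ρ) (homW σ) (homW τ) (f.compLeft (Fin m)) (g.compLeft (Fin m)) := by
  refine ⟨h.hf.homW, h.hg.homW, h.inj.comp_left, h.surj.comp_left, ?_⟩
  intro b
  constructor
  · intro hb
    choose a ha using fun ω => (h.ex (b ω)).1 (congrFun hb ω)
    exact ⟨a, funext ha⟩
  · rintro ⟨a, rfl⟩
    ext ω
    exact (h.ex _).2 ⟨a ω, rfl⟩

lemma homW_R (ρ : Representation F (PQ F m) Y) :
    rs (RR F m).subtype (homW ρ) = piRep (fun _ : Fin m => rs (RR F m).subtype ρ) := by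
  refine MonoidHom.ext fun g => LinearMap.ext fun f => funext fun i => ?_
  have hg : g.1.h = 1 := g.2
  show homW ρ g.1 f i = ρ g.1 (f i)
  rw [homW_apply, hg]
  simp [Matrix.one_apply]

lemma cd_homW_R (ρ : Representation F (PQ F m) Y) (j : ℕ) (h : cd (rs (RR F m).subtype ρ) j = 0) :
    cd (rs (RR F m).subtype (homW ρ)) j = 0 := by
  rw [homW_R]
  exact cd_piRep _ j fun _ => h

lemma cd_homW [Finite F] (ρ : Representation F (PQ F m) Y) (j : ℕ)
    (h : ∀ i ≤ j, cd (rs (RR F m).subtype ρ) i = 0) : cd (homW ρ) j = 0 :=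
  lemV (RR F m) j _ fun i hi => cd_homW_R ρ i (h i hi)

end

variable (F m) in
def inH : GL (Fin m) F →* PQ F m where
  toFun h := ⟨1, 0, h⟩
  map_one' := rfl
  map_mul' h h' := by ext : 1 <;> simp [PQ.mul_v]

lemma lemCQ [Finite F] {M : Type} [AddCommGroup M] [Module F M] [FiniteDimensional F M]
    (j : ℕ) (ρ : Representation F (PQ F m) M) (htriv : ∀ r ∈ RR F m, ∀ x, ρ r x = x)
    (h1 : ∀ i, 1 ≤ i → i ≤ j + 1 → cd (rs (RR F m).subtype ρ) i = 0)
    (h2 : ∀ i, 1 ≤ i → i ≤ j + 1 → cd (rs (inH F m) ρ) i = 0) : cd ρ (j+1) = 0 := by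
  have hinj : Function.Injective (inH F m) := fun x y h => congrArg PQ.h h
  refine lemC (RR F m) (inH F m).range ?_ ?_ j ρ htriv h1 ?_
  · intro g
    refine ⟨⟨g.a, g.v ᵥ* (g.h⁻¹).1, 1⟩, rfl, inH F m g.h, ⟨_, rfl⟩, ?_⟩
    ext : 1
    · simp [inH]
    · simp [inH, PQ.mul_v]
    · simp [inH]
  · rintro _ hg ⟨h, rfl⟩
    have : h = 1 := hg
    rw [this, map_one]
  · intro i hi hi'
    rw [← cd_groupIso (MonoidHom.ofInjective hinj)]
    exact h2 i hi hi'

lemma rs_chi {Γ Δ : Type} [Group Γ] [Group Δ] (φ : Δ →* Γ) (χ : Γ →* Fˣ) :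
    rs φ (chi χ) = chi (χ.comp φ) := rfl

lemma rs_triv {Γ Δ : Type} [Group Γ] [Group Δ] (φ : Δ →* Γ) :
    rs φ (chi (1 : Γ →* Fˣ)) = chi 1 := rfl

end

section
variable (F : Type) [Field F] (m : ℕ) [Fintype F] (p r : ℕ) [hp : Fact p.Prime] [CharP F p] (hq : Fintype.card F = p^r)
  (hp5 : 5 ≤ p)
include hq hp5

lemma triv_Q (h : ∀ j, 1 ≤ j → j ≤ 3 → cd (chi (1 : GL (Fin m) F →* Fˣ)) j = 0) :
    ∀ j, 1 ≤ j → j ≤ 3 → cd (chi (1 : PQ F m →* Fˣ)) j = 0 := by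
  intro j h1 h2
  obtain ⟨j, rfl⟩ : ∃ i, j = i + 1 := ⟨j-1, by omega⟩
  refine lemCQ j _ ?_ ?_ ?_
  · intro r _ x; simp
  · intro i h3 h4
    rw [rs_triv]
    exact (R_facts F m p r hq hp5).1 i h3 (by omega)
  · intro i h3 h4
    rw [rs_triv]
    exact h i h3 (by omega)

lemma triv_GL : ∀ j, 1 ≤ j → j ≤ 3 → cd (chi (1 : GL (Fin m) F →* Fˣ)) j = 0 := by
  induction m with
  | zero =>
    intro j h1 h2
    obtain ⟨j, rfl⟩ : ∃ i, j = i + 1 := ⟨j-1, by omega⟩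
    exact cd_trivial_group _ j
  | succ m ih =>
    intro j h1 h2
    refine le_antisymm ((cd_le_PQ m _ j).trans ?_) zero_le
    rw [rs_triv, triv_Q F m p r hq hp5 ih j h1 h2]

lemma twW : ∀ j ≤ 3, cd (twist (PQ.aH F m)⁻¹ (WW F m)) j = 0 := by
  have hR : ∀ j ≤ 2, cd (rs (RR F m).subtype (twist (PQ.aH F m)⁻¹ (WW F m))) j = 0 := by
    intro j hj
    have e : rs (RR F m).subtype (twist (PQ.aH F m)⁻¹ (WW F m)) =
        piRep (fun _ : Fin m => chi (aR F m)⁻¹) := by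
      refine MonoidHom.ext fun g => LinearMap.ext fun f => funext fun i => ?_
      have hg : g.1.h = 1 := g.2
      show ((g.1.a⁻¹ : Fˣ) : F) * (g.1.h.1 *ᵥ f) i = ((g.1.a⁻¹ : Fˣ) : F) * f i
      rw [hg]
      simp
    rw [e]
    exact cd_piRep _ j fun _ => (R_facts F m p r hq hp5).2.2 j hj
  intro j hj
  rcases Nat.lt_or_ge j 3 with h | h
  · exact lemV (RR F m) j _ fun i hi => hR i (by omega)
  · obtain rfl : j = 3 := by omega
    refine le_antisymm ((lemV' (RR F m) (KK F m) (RR_le_KK F m) 2 _ hR).trans ?_) zero_le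
    have e : rs (KK F m).subtype (twist (PQ.aH F m)⁻¹ (WW F m)) =
        piRep (fun i : Fin m => chi ((aK F m)⁻¹ * dKi F m i)) := by
      refine MonoidHom.ext fun g => LinearMap.ext fun f => funext fun i => ?_
      show ((g.1.a⁻¹ : Fˣ) : F) * (g.1.h.1 *ᵥ f) i = ((g.1.a⁻¹ * dK F m g i : Fˣ) : F) * f i
      rw [← dK_spec g, dg_coe, Matrix.mulVec_diagonal, Units.val_mul, mul_assoc]
    rw [e]
    exact le_of_eq (cd_piRep _ 3 fun i => K_facts F m p r hq hp5 i)

lemma twV : ∀ j, 1 ≤ j → j ≤ 3 → cd (twist (PQ.aH F m)⁻¹ (VV F m)) j = 0 := by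
  intro j h1 h2
  have h := (V_ses (F := F) (m := m)).twist (PQ.aH F m)⁻¹
  refine le_antisymm ((h.mid j).trans ?_) zero_le
  have e : twist (PQ.aH F m)⁻¹ (chi (PQ.aH F m)) = chi 1 := by
    refine MonoidHom.ext fun g => LinearMap.ext fun x => ?_
    show ((g.a⁻¹ : Fˣ) : F) * ((g.a : F) * x) = ((1 : Fˣ) : F) * x
    simp
  rw [twW F m p r hq hp5 j h2, e, triv_Q F m p r hq hp5 (triv_GL F m p r hq hp5) j h1 h2, zero_add]

end
end GLC

namespace GLC
open Matrix

section
variable {F : Type} [Field F] {m : ℕ}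

lemma glConj_apply {n : ℕ} (g : GL (Fin n) F) (x : Matrix (Fin n) (Fin n) F) :
    glConj F n g x = g.1 * x * g⁻¹.1 := rfl

lemma homW_sum {Y : Type} [AddCommGroup Y] [Module F Y] (ρ : Representation F (PQ F m) Y)
    (g : PQ F m) (f : Fin m → Y) (s : Fin m) :
    ∑ i, g.h.1 i s • homW ρ g f i = ρ g (f s) := by
  simp only [homW_apply, Finset.smul_sum, smul_smul]
  rw [Finset.sum_comm]
  have h1 : (g.h⁻¹).1 * g.h.1 = 1 := by rw [← Units.val_mul, inv_mul_cancel]; rfl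
  have h2 : ∀ j, ∑ i, (g.h.1 i s * (g.h⁻¹).1 j i) • ρ g (f j) = (1 : Matrix (Fin m) (Fin m) F) j s • ρ g (f j) := by
    intro j
    rw [← h1, Matrix.mul_apply, Finset.sum_smul]
    exact Finset.sum_congr rfl fun i _ => by rw [mul_comm]
  rw [Finset.sum_congr rfl fun j _ => h2 j]
  simp [Matrix.one_apply]

variable (F m) in
def glF : (Fin m → F × (Fin m → F)) →ₗ[F] Matrix (Fin (m+1)) (Fin (m+1)) F where
  toFun X := Matrix.of (Fin.cons (Fin.cons 0 (fun i => (X i).1)) (fun j => Fin.cons 0 (fun i => (X i).2 j)))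
  map_add' X Y := by
    ext i j
    refine Fin.cases ?_ (fun i => ?_) i <;> refine Fin.cases ?_ (fun j => ?_) j <;> simp
  map_smul' c X := by
    ext i j
    refine Fin.cases ?_ (fun i => ?_) i <;> refine Fin.cases ?_ (fun j => ?_) j <;> simp

@[simp] lemma glF0 (X : Fin m → F × (Fin m → F)) (i) : glF F m X i 0 = 0 := by
  refine Fin.cases ?_ (fun i => ?_) i <;> rfl
@[simp] lemma glF0s (X : Fin m → F × (Fin m → F)) (i : Fin m) : glF F m X 0 i.succ = (X i).1 := rfl
@[simp] lemma glFss (X : Fin m → F × (Fin m → F)) (i j : Fin m) :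
    glF F m X j.succ i.succ = (X i).2 j := rfl

variable (F m) in
def glG : Matrix (Fin (m+1)) (Fin (m+1)) F →ₗ[F] F × (Fin m → F) where
  toFun M := (M 0 0, fun j => M j.succ 0)
  map_add' X Y := rfl
  map_smul' c X := rfl

@[simp] lemma glG_apply (M : Matrix (Fin (m+1)) (Fin (m+1)) F) :
    glG F m M = (M 0 0, fun j => M j.succ 0) := rfl

lemma gl_ses : SES (homW (VV F m)) (rs (PQ.iota F m) (glConj F (m+1)))
    (twist (PQ.aH F m)⁻¹ (VV F m)) (glF F m) (glG F m) := by
  refine ⟨?_, ?_, ?_, ?_, ?_⟩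
  · intro g X
    rw [rs_apply, glConj_apply]
    have key : glF F m (homW (VV F m) g X) * (PQ.iota F m g).1 = (PQ.iota F m g).1 * glF F m X := by
      ext i s
      refine Fin.cases ?_ (fun s => ?_) s
      · simp [Matrix.mul_apply, Fin.sum_univ_succ]
      · have h := homW_sum (VV F m) g X s
        refine Fin.cases ?_ (fun i => ?_) i
        · have h1 := congrArg Prod.fst h
          rw [Prod.fst_sum] at h1
          simp only [VV_apply, Prod.smul_fst, smul_eq_mul] at h1
          simp only [Matrix.mul_apply, Fin.sum_univ_succ, glF0, glF0s, glFss, PQ.iota_coe, PQ.mat0s,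
            PQ.matss, PQ.mat00, zero_mul, zero_add]
          refine Eq.trans ?_ h1
          exact Finset.sum_congr rfl fun _ _ => mul_comm _ _
        · have h1 := congrFun (congrArg Prod.snd h) i
          rw [Prod.snd_sum, Finset.sum_apply] at h1
          simp only [VV_apply, Prod.smul_snd, Pi.smul_apply, smul_eq_mul] at h1
          simp only [Matrix.mul_apply, Fin.sum_univ_succ, glF0, glF0s, glFss, PQ.iota_coe, PQ.mat0s,
            PQ.matss, PQ.mats0, zero_mul, zero_add]
          refine Eq.trans ?_ h1
          exact Finset.sum_congr rfl fun _ _ => mul_comm _ _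
    rw [← key, Matrix.mul_assoc, ← Units.val_mul, mul_inv_cancel, Units.val_one, Matrix.mul_one]
  · intro g M
    have e : (PQ.iota F m g)⁻¹.1 = (g⁻¹).mat := by rw [← map_inv]; rfl
    rw [rs_apply, glConj_apply, e]
    ext i
    · simp [Matrix.mul_apply, Fin.sum_univ_succ, dotProduct]
      ring
    · simp [Matrix.mul_apply, Fin.sum_univ_succ, Matrix.mulVec, dotProduct]
      ring
  · intro X Y h
    funext i
    ext j
    · exact congrFun (congrFun h 0) i.succ
    · exact congrFun (congrFun h j.succ) i.succ
  · intro x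
    refine ⟨Matrix.of (Fin.cons (fun _ => x.1) (fun j _ => x.2 j)), ?_⟩
    simp
  · intro M
    constructor
    · intro h
      refine ⟨fun i => (M 0 i.succ, fun j => M j.succ i.succ), ?_⟩
      have h1 : M 0 0 = 0 := congrArg Prod.fst h
      have h2 : ∀ j : Fin m, M j.succ 0 = 0 := fun j => congrFun (congrArg Prod.snd h) j
      ext i j
      refine Fin.cases ?_ (fun i => ?_) i <;> refine Fin.cases ?_ (fun j => ?_) j <;> simp [h1, h2]
    · rintro ⟨X, rfl⟩
      simp
      rfl

variable (F m) in
def sN : PQ F m →* Equiv.Perm (Fin m → F) :=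
  MonoidHom.toHomPerm
    { toFun := fun g x => ((g.a : F) • x + g.v) ᵥ* (g.h⁻¹).1
      map_one' := by
        funext x
        refine Eq.trans ?_ (rfl : x = _)
        simp
      map_mul' := fun g h => by
        funext x
        show (((g * h).a : F) • x + (g * h).v) ᵥ* ((g * h).h⁻¹).1 =
          ((g.a : F) • (((h.a : F) • x + h.v) ᵥ* (h.h⁻¹).1) + g.v) ᵥ* (g.h⁻¹).1
        simp only [PQ.mul_h, PQ.mul_v, PQ.mul_a,
          _root_.mul_inv_rev, Units.val_mul, Matrix.add_vecMul, Matrix.smul_vecMul, smul_add,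
          smul_smul, ← Matrix.vecMul_vecMul]
        have e : h.h.1 * (h.h⁻¹).1 = 1 := by rw [← Units.val_mul, mul_inv_cancel]; rfl
        rw [Matrix.vecMul_vecMul (g.v), e]
        simp [add_assoc] }

lemma sN_apply (g : PQ F m) (x : Fin m → F) : sN F m g x = ((g.a : F) • x + g.v) ᵥ* (g.h⁻¹).1 := rfl

variable (F m) in
abbrev FF : Representation F (PQ F m) ((Fin m → F) → F) := funRep (sN F m) (chi (PQ.aH F m))

variable (F m) in
def phi : (F × (Fin m → F)) →ₗ[F] ((Fin m → F) → F) where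
  toFun X x := X.1 - x ⬝ᵥ X.2
  map_add' X Y := by ext x; simp [dotProduct_add]; ring
  map_smul' c X := by ext x; simp [dotProduct_smul]; ring

@[simp] lemma phi_apply (X : F × (Fin m → F)) (x) : phi F m X x = X.1 - x ⬝ᵥ X.2 := rfl

lemma phi_eqv : Eqv (VV F m) (FF F m) (phi F m) := by
  intro g X
  funext x
  show (g.a : F) * X.1 + g.v ⬝ᵥ X.2 - x ⬝ᵥ (g.h.1 *ᵥ X.2) = (g.a : F) * (X.1 - (sN F m g⁻¹ x) ⬝ᵥ X.2)
  rw [sN_apply, PQ.inv_v, PQ.inv_a, PQ.inv_h, inv_inv, Matrix.add_vecMul, Matrix.smul_vecMul,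
    Matrix.smul_vecMul, Matrix.vecMul_vecMul, ← Units.val_mul, inv_mul_cancel, Units.val_one,
    Matrix.vecMul_one, add_dotProduct, smul_dotProduct, smul_dotProduct, Matrix.dotProduct_mulVec]
  simp only [smul_eq_mul]
  have := Units.mul_inv g.a
  linear_combination (x ᵥ* g.h.1 ⬝ᵥ X.2 - g.v ⬝ᵥ X.2) * this

lemma phi_inj : Function.Injective (phi F m) := by
  rw [← LinearMap.ker_eq_bot, LinearMap.ker_eq_bot']
  intro X hX
  have h0 : X.1 = 0 := by simpa using congrFun hX 0
  refine Prod.ext h0 ?_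
  funext i
  have h1 := congrFun hX (Pi.single i 1)
  simpa [h0] using h1

variable (F m) in
abbrev DD : Representation F (PQ F m) (((Fin m → F) → F) ⧸ LinearMap.range (phi F m)) :=
  cok (phi_eqv (F := F) (m := m))

lemma D_ses : SES (VV F m) (FF F m) (DD F m) (phi F m) (LinearMap.range (phi F m)).mkQ :=
  cok_ses phi_eqv phi_inj

lemma WW_R : rs (RR F m).subtype (WW F m) = piRep (fun _ : Fin m => chi 1) := by
  refine MonoidHom.ext fun g => LinearMap.ext fun f => funext fun i => ?_
  have hg : g.1.h = 1 := g.2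
  show (g.1.h.1 *ᵥ f) i = 1 * f i
  rw [hg]
  simp

lemma WW_R0 : cd (rs (RR F m).subtype (WW F m)) 0 = m := by
  rw [cd_H0_triv]
  · rw [Module.length_eq_finrank]; simp
  · intro g w
    have hg : g.1.h = 1 := g.2
    show g.1.h.1 *ᵥ w = w
    rw [hg]
    simp

end

section
variable (F : Type) [Field F] (m : ℕ) [Fintype F] (p r : ℕ) [hp : Fact p.Prime] [CharP F p] (hq : Fintype.card F = p^r)
  (hp5 : 5 ≤ p)
include hq hp5

lemma exists_z : ∃ z : Fˣ, z ≠ 1 := by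
  obtain ⟨z, hz, -⟩ := exists_zeta F p r hq
  refine ⟨z, fun h => ?_⟩
  rw [h, orderOf_one] at hz
  omega

lemma W_R (j : ℕ) (h1 : 1 ≤ j) (h2 : j ≤ 3) : cd (rs (RR F m).subtype (WW F m)) j = 0 := by
  rw [WW_R]
  exact cd_piRep _ j fun _ => (R_facts F m p r hq hp5).1 j h1 h2

lemma V_R0 : cd (rs (RR F m).subtype (VV F m)) 0 = 0 := by
  rw [cd_H0_zero]
  intro x hx
  obtain ⟨z, hz⟩ := exists_z F p r hq hp5
  have h1 : x.2 = 0 := by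
    funext i
    have := congrArg Prod.fst (hx ⟨⟨1, Pi.single i 1, 1⟩, rfl⟩)
    simpa using this
  have h2 := congrArg Prod.fst (hx ⟨⟨z, 0, 1⟩, rfl⟩)
  have h3 : (z : F) * x.1 = x.1 := by simpa using h2
  refine Prod.ext ?_ h1
  by_contra h
  exact hz (Units.ext (mul_right_cancel₀ h (h3.trans (one_mul x.1).symm)))

lemma V_R1 : cd (rs (RR F m).subtype (VV F m)) 1 = 0 := by
  have h := (V_ses (F := F) (m := m)).rs (RR F m).subtype
  have hf := (R_facts F m p r hq hp5).2.1
  have := h.refd (V_R0 F m p r hq hp5) (by rw [WW_R0]; exact hf.2.2.1)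
    (ne_top_of_le_ne_top (by simp) hf.2.2.1)
  rw [W_R F m p r hq hp5 1 le_rfl (by omega)] at this
  exact le_antisymm this zero_le

lemma V_R2 : cd (rs (RR F m).subtype (VV F m)) 2 ≤ m := by
  have h := (V_ses (F := F) (m := m)).rs (RR F m).subtype
  have hf := (R_facts F m p r hq hp5).2.1
  refine (h.mid 2).trans ?_
  rw [W_R F m p r hq hp5 2 (by omega) (by omega), add_zero]
  exact hf.2.2.2

lemma V_R3 : cd (rs (RR F m).subtype (VV F m)) 3 = 0 := by
  have h := (V_ses (F := F) (m := m)).rs (RR F m).subtype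
  have hf := (R_facts F m p r hq hp5).2.1
  refine le_antisymm ((h.mid 3).trans ?_) zero_le
  rw [W_R F m p r hq hp5 3 (by omega) (by omega), add_zero]
  exact le_of_eq hf.2.1

lemma F_R (j : ℕ) : cd (rs (RR F m).subtype (FF F m)) j = 0 := by
  have e : rs (RR F m).subtype (FF F m) = funRep ((sN F m).comp (RR F m).subtype) (chi (aR F m)) := rfl
  rw [e, shapiro _ _ 0 ?_ (SR F m) ?_ j]
  · cases j with
    | succ j => exact cd_prime_to_p _ (card_SR F m) j
    | zero =>
      rw [cd_H0_zero]
      intro x hx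
      obtain ⟨z, hz⟩ := exists_z F p r hq hp5
      have h2 : (z : F) * x = x := hx ⟨kap F m z, ⟨z, rfl⟩⟩
      by_contra h
      exact hz (Units.ext (mul_right_cancel₀ h (h2.trans (one_mul x).symm)))
  · intro x
    refine ⟨⟨⟨1, x, 1⟩, rfl⟩, ?_⟩
    show sN F m ⟨1, x, 1⟩ 0 = x
    rw [sN_apply]
    simp
  · intro g
    have hg : g.1.h = 1 := g.2
    rw [mem_SR]
    show _ ↔ sN F m g.1 0 = 0
    rw [sN_apply, hg]
    simp

lemma D_R0 : cd (rs (RR F m).subtype (DD F m)) 0 = 0 := by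
  have h := (D_ses (F := F) (m := m)).rs (RR F m).subtype
  refine le_antisymm ((h.C1 0).trans ?_) zero_le
  rw [F_R F m p r hq hp5 0, V_R1 F m p r hq hp5, add_zero]

lemma D_R1 : cd (rs (RR F m).subtype (DD F m)) 1 ≤ m := by
  have h := (D_ses (F := F) (m := m)).rs (RR F m).subtype
  refine (h.C1 1).trans ?_
  rw [F_R F m p r hq hp5 1, zero_add]
  exact V_R2 F m p r hq hp5

lemma D_R2 : cd (rs (RR F m).subtype (DD F m)) 2 = 0 := by
  have h := (D_ses (F := F) (m := m)).rs (RR F m).subtype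
  refine le_antisymm ((h.C1 2).trans ?_) zero_le
  rw [F_R F m p r hq hp5 2, V_R3 F m p r hq hp5, add_zero]

lemma gl_le (j : ℕ) (h1 : 1 ≤ j) (h2 : j ≤ 3) : cd (glConj F (m+1)) j ≤ cd (homW (VV F m)) j := by
  refine (cd_le_PQ m _ j).trans ((gl_ses.mid j).trans ?_)
  rw [twV F m p r hq hp5 j h1 h2, add_zero]

lemma gl_one : cd (glConj F m) 1 = 0 := by
  cases m with
  | zero => exact cd_zero_of_subsingleton _ _
  | succ m =>
    refine le_antisymm ((gl_le F m p r hq hp5 1 le_rfl (by omega)).trans (le_of_eq ?_)) zero_le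
    refine cd_homW _ 1 fun i hi => ?_
    obtain rfl | rfl : i = 0 ∨ i = 1 := by omega
    · exact V_R0 F m p r hq hp5
    · exact V_R1 F m p r hq hp5

end
end GLC

namespace GLC
open Matrix

section
variable {K Γ A : Type} [Field K] [Group Γ] [AddCommGroup A] [Module K A]

lemma cd2_zero {ρ : Representation K Γ A} (h : cd ρ 2 = 0) (f : Γ × Γ → A)
    (hf : ∀ x y z, f (x * y, z) + f (x, y) = ρ x (f (y, z)) + f (x, y * z)) :
    ∃ b : Γ → A, ∀ x y, f (x, y) = ρ x (b y) - b (x * y) + b x := by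
  have hs : Subsingleton (groupCohomology (Rep.of ρ) 2) := Module.length_eq_zero_iff.1 h
  have hm : f ∈ groupCohomology.cocycles₂ (Rep.of ρ) := (groupCohomology.mem_cocycles₂_iff _).2 hf
  have h0 : groupCohomology.H2π (Rep.of ρ) ⟨f, hm⟩ = 0 := Subsingleton.elim (α := groupCohomology (Rep.of ρ) 2) _ _
  obtain ⟨b, hb⟩ := (groupCohomology.H2π_eq_zero_iff _).1 h0
  refine ⟨b, fun x y => ?_⟩
  have := congrFun hb (x, y)
  exact this.symm

lemma cd1_ne {ρ : Representation K Γ A} (h : cd ρ 1 ≠ 0) :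
    ∃ f : Γ → A, (∀ x y, f (x * y) = ρ x (f y) + f x) ∧ ¬ ∃ a : A, ∀ x, f x = ρ x a - a := by
  by_contra! hc
  apply h
  rw [cd, Module.length_eq_zero_iff]
  have key : ∀ z : groupCohomology (Rep.of ρ) 1, z = 0 := by
    intro z
    obtain ⟨f, rfl⟩ : ∃ f, groupCohomology.H1π (Rep.of ρ) f = z :=
      (ModuleCat.epi_iff_surjective _).1 inferInstance z
    refine (groupCohomology.H1π_eq_zero_iff _).2 ?_
    obtain ⟨a, ha⟩ := hc f.1 ((groupCohomology.mem_cocycles₁_iff _).1 f.2)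
    exact ⟨a, funext fun x => (ha x).symm⟩
  exact ⟨fun x y => (key x).trans (key y).symm⟩

end

/-- square-zero extension data -/
structure Lft {M N : Type} [Ring M] [Ring N] (q : M →+* N) (p : ℕ) : Prop where
  surj : Function.Surjective q
  ex : ∀ x, q x = 0 → ∃ y, x = (p : M) * y
  tor : ∀ y, (p : M) * y = 0 ↔ q y = 0

section
variable {O F : Type} [CommRing O] [CommRing F] {q : O →+* F} {p : ℕ}

lemma Lft.mat (h : Lft q p) (n : ℕ) : Lft (q.mapMatrix (m := Fin n)) p := by
  refine ⟨?_, ?_, ?_⟩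
  · intro X
    choose Y hY using fun i j => h.surj (X i j)
    exact ⟨Matrix.of Y, by ext i j; simp [hY]⟩
  · intro X hX
    choose Y hY using fun i j => h.ex (X i j) (congrFun (congrFun hX i) j)
    refine ⟨Matrix.of Y, ?_⟩
    ext i j
    rw [← nsmul_eq_mul]
    simp [hY]
  · intro Y
    rw [← nsmul_eq_mul, ← Matrix.ext_iff, ← Matrix.ext_iff]
    refine forall_congr' fun i => forall_congr' fun j => ?_
    have := h.tor (Y i j)
    simpa using this
end

section
variable {M N : Type} [Ring M] [Ring N] {q : M →+* N} {p : ℕ}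

lemma Lft.sq (h : Lft q p) [CharP N p] (x : M) : (p : M) * ((p : M) * x) = 0 := by
  rw [h.tor]; simp

lemma Lft.pow (h : Lft q p) [CharP N p] (hp : p.Prime) (hp5 : 5 ≤ p) (B : M) (hB : q (B * B) = 0) :
    (1 + B)^p = 1 + (p : M) * B := by
  obtain ⟨C, hC⟩ := h.ex _ hB
  have cm : ∀ x : M, (p : M) * x = x * p := fun x => (Nat.cast_commute p x).eq
  have hB4 : B * B * (B * B) = 0 := by
    rw [hC, mul_assoc, ← mul_assoc C, ← cm C, mul_assoc]
    exact h.sq _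
  rw [add_comm, (Commute.one_right B).add_pow]
  have h0 : ∀ i ∈ Finset.range (p+1), i ≠ 0 ∧ i ≠ 1 → B^i * 1^(p-i) * (p.choose i : M) = 0 := by
    intro i hi h1
    rw [Finset.mem_range] at hi
    obtain ⟨j, rfl⟩ : ∃ j, i = j + 2 := ⟨i - 2, by omega⟩
    rw [one_pow, mul_one]
    rcases Nat.lt_or_ge (j+2) p with hlt | hge
    · obtain ⟨c, hc⟩ := hp.dvd_choose_self (by omega) hlt
      rw [hc, pow_add, pow_two, hC, Nat.cast_mul, ← mul_assoc, ← cm, ← mul_assoc (B^j), ← cm (B^j), mul_assoc (p : M) (B^j)]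
      rw [← mul_assoc (p : M) (p : M), mul_assoc ((p : M) * p), mul_assoc (p : M) (p : M)]
      exact h.sq _
    · obtain ⟨l, rfl⟩ : ∃ l, j = l + 2 := ⟨j - 2, by omega⟩
      have : B^(l+2+2) = B^l * (B * B * (B * B)) := by
        rw [pow_add, pow_add, pow_two, mul_assoc]
      rw [this, hB4]
      simp
  rw [Finset.sum_eq_add_of_mem 0 1 (by simp) (by simp; exact hp.pos) (by simp) h0]
  simp [cm]

lemma Lft.no_lift (h : Lft q p) [CharP N p] (hp : p.Prime) (hp5 : 5 ≤ p) {Γ : Type} [Group Γ]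
    (t : Γ → M) (ht : ∀ x y, t (x * y) = t x * t y) (h1 : q (t 1) = 1) (u : Γ) (hu : u^p = 1)
    (E : M) (hE : E * E = 0) (hq : q (t u) = 1 + q E) : q E = 0 := by
  have t1 : t 1 = 1 := by
    obtain ⟨X, hX⟩ := h.ex (t 1 - 1) (by simp [h1])
    have e := ht 1 1
    have e1 : t 1 = 1 + p * X := by rw [← hX]; abel
    rw [mul_one, e1] at e
    have cm : ∀ x : M, (p : M) * x = x * p := fun x => (Nat.cast_commute p x).eq
    have e2 : (p : M) * X = 0 := by
      have h3 : (p : M) * X * ((p : M) * X) = 0 := by rw [mul_assoc, ← mul_assoc X, ← cm X, mul_assoc]; exact h.sq _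
      have h4 : (1 + (p : M) * X) * (1 + p * X) = 1 + (p : M) * X + ((p : M) * X + (p : M) * X * ((p : M) * X)) := by
        noncomm_ring
      rw [h4, h3, add_zero] at e
      exact left_eq_add.1 e
    rw [e1, e2, add_zero]
  let T : Γ →* M := { toFun := t, map_one' := t1, map_mul' := ht }
  have hT : t u ^ p = 1 := by
    have := map_pow T u p
    rw [hu, map_one] at this
    exact this.symm
  have hB : q (t u - 1) = q E := by simp [hq]
  have e := h.pow hp hp5 (t u - 1) (by rw [map_mul, hB, ← map_mul, hE, map_zero])
  rw [add_sub_cancel, hT] at e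
  rw [← hB]
  exact (h.tor _).1 (left_eq_add.1 e)

end

lemma exists_Lft (F : Type) [Field F] [Finite F] (p : ℕ) [hp : Fact p.Prime] [CharP F p] :
    ∃ (O : Type) (_ : CommRing O) (q : O →+* F), Lft q p := by
  let I : Ideal (WittVector p F) := Ideal.span {(p : WittVector p F) * p}
  have kc : ∀ x : WittVector p F, WittVector.constantCoeff x = 0 ↔ ∃ y, x = (p : WittVector p F) * y := by
    intro x
    rw [← RingHom.mem_ker, WittVector.ker_constantCoeff, Ideal.mem_span_singleton]
    rfl
  refine ⟨WittVector p F ⧸ I, inferInstance, Ideal.Quotient.lift I WittVector.constantCoeff ?_, ?_, ?_, ?_⟩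
  · intro a ha
    obtain ⟨c, rfl⟩ := Ideal.mem_span_singleton.1 ha
    exact (kc _).2 ⟨_, mul_assoc _ _ _⟩
  · apply Ideal.Quotient.lift_surjective_of_surjective
    exact WittVector.constantCoeff_surjective p
  · intro x hx
    obtain ⟨x, rfl⟩ := Ideal.Quotient.mk_surjective x
    rw [Ideal.Quotient.lift_mk, kc] at hx
    obtain ⟨y, rfl⟩ := hx
    exact ⟨Ideal.Quotient.mk I y, by simp⟩
  · intro y
    obtain ⟨y, rfl⟩ := Ideal.Quotient.mk_surjective y
    rw [Ideal.Quotient.lift_mk, kc]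
    have e : (p : WittVector p F ⧸ I) * Ideal.Quotient.mk I y = Ideal.Quotient.mk I (p * y) := by simp
    rw [e, Ideal.Quotient.eq_zero_iff_mem, Ideal.mem_span_singleton]
    have h0 : (p : WittVector p F) ≠ 0 := WittVector.p_nonzero p F
    rw [mul_dvd_mul_iff_left h0]
    rfl

lemma gl_two_ne (F : Type) [Field F] [Finite F] (p : ℕ) [hp : Fact p.Prime] [CharP F p] (hp5 : 5 ≤ p)
    (n : ℕ) (hn : 2 ≤ n) : cd (glConj F n) 2 ≠ 0 := by
  intro hz
  obtain ⟨O, _, q0, h0⟩ := exists_Lft F p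
  have h := h0.mat n
  haveI : Nonempty (Fin n) := ⟨⟨0, by omega⟩⟩
  set q := q0.mapMatrix (m := Fin n) with hqdef
  choose s hs using h.surj
  have hY0 : ∀ x y : GL (Fin n) F, q (s x.1 * s y.1 - s (x * y).1) = 0 := by
    intro x y; simp only [map_sub, map_mul, hs, Units.val_mul, sub_self]
  choose Y hY using fun x y : GL (Fin n) F => h.ex _ (hY0 x y)
  have cm : ∀ x : Matrix (Fin n) (Fin n) O, (p : Matrix (Fin n) (Fin n) O) * x = x * p :=
    fun x => (Nat.cast_commute p x).eq
  obtain ⟨b, hb⟩ := cd2_zero hz (fun z => q (Y z.1 z.2) * (z.1 * z.2)⁻¹.1) (by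
    intro x y z
    have e1 : q (s x.1 * Y y z - Y (x * y) z + Y x (y * z) - Y x y * s z.1) = 0 := by
      rw [← h.tor, mul_sub, mul_add, mul_sub, ← mul_assoc, cm (s x.1), mul_assoc, ← hY, ← hY, ← hY,
        ← mul_assoc (p : Matrix (Fin n) (Fin n) O), ← hY, mul_assoc x y z]
      noncomm_ring
    simp only [map_sub, map_add, map_mul, hs] at e1
    rw [glConj_apply]
    show q (Y (x * y) z) * (x * y * z)⁻¹.1 + q (Y x y) * (x * y)⁻¹.1 =
      x.1 * (q (Y y z) * (y * z)⁻¹.1) * x⁻¹.1 + q (Y x (y * z)) * (x * (y * z))⁻¹.1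
    have e2 : (x * y)⁻¹.1 = z.1 * (x * y * z)⁻¹.1 := by
      rw [← Units.val_mul]; congr 1; group
    have e3 : (y * z)⁻¹.1 * x⁻¹.1 = (x * y * z)⁻¹.1 := by
      rw [← Units.val_mul]; congr 1; group
    rw [e2, ← mul_assoc x y z, mul_assoc (x.1), mul_assoc (q (Y y z)), e3, ← mul_assoc x.1, ← mul_assoc (q (Y x y)),
      ← add_mul, ← add_mul]
    congr 1
    rw [← sub_eq_zero, ← neg_eq_zero, ← e1]
    abel)
  choose B hB using fun x : GL (Fin n) F => h.surj (b x * x.1)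
  let i0 : Fin n := ⟨0, by omega⟩
  let i1 : Fin n := ⟨1, by omega⟩
  have hi : i0 ≠ i1 := by simp [i0, i1]
  have hE : ∀ (R : Type) [CommRing R], (Matrix.single i0 i1 (1 : R)) * (Matrix.single i0 i1 (1 : R)) = 0 := by
    intro R _
    exact Matrix.single_mul_single_of_ne _ _ _ _ hi.symm _
  let u : GL (Fin n) F := ⟨1 + Matrix.single i0 i1 1, 1 - Matrix.single i0 i1 1,
    by rw [add_mul, mul_sub, mul_sub, hE]; simp, by rw [sub_mul, mul_add, mul_add, hE]; simp⟩
  have hu : u^p = 1 := by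
    ext1
    rw [Units.val_pow_eq_pow_val, Units.val_one]
    show (1 + Matrix.single i0 i1 (1:F))^p = 1
    rw [add_pow_char_of_commute (p := p) (h := Commute.one_left _), one_pow]
    have : Matrix.single i0 i1 (1:F) ^ p = 0 := by
      obtain ⟨l, hl⟩ : ∃ l, p = 2 + l := ⟨p - 2, by omega⟩
      rw [hl, pow_add, pow_two, hE, zero_mul]
    rw [this, add_zero]
  have e0 : q (Matrix.single i0 i1 1) = Matrix.single i0 i1 1 := by
    ext i j
    simp [hqdef, Matrix.single_apply]
  have key := h.no_lift hp.out hp5 (fun x : GL (Fin n) F => s x.1 - p * B x) ?_ ?_ u hu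
    (Matrix.single i0 i1 1) (hE O) ?_
  · have := congrFun (congrFun key i0) i1
    rw [e0] at this
    simp at this
  · intro x y
    have e1 : q (Y x y - B x * s y.1 - s x.1 * B y + B (x * y)) = 0 := by
      simp only [map_sub, map_add, map_mul, hs, hB]
      have e := hb x y
      rw [glConj_apply] at e
      have e' : q (Y x y) = (x.1 * b y * x⁻¹.1 - b (x * y) + b x) * (x * y).1 := by
        rw [← e, mul_assoc, ← Units.val_mul, inv_mul_cancel]; simp
      rw [e', add_mul, sub_mul]
      have e3 : x.1 * b y * x⁻¹.1 * (x * y).1 = x.1 * (b y * y.1) := by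
        rw [mul_assoc, ← Units.val_mul, inv_mul_cancel_left, mul_assoc]
      rw [e3, Units.val_mul]
      noncomm_ring
    rw [← h.tor, mul_add, mul_sub, mul_sub, ← hY] at e1
    have e2 : (p : Matrix (Fin n) (Fin n) O) * B x * (p * B y) = 0 := by
      rw [mul_assoc, ← mul_assoc (B x), ← cm (B x), mul_assoc]
      exact h.sq _
    have e3 : (p : Matrix (Fin n) (Fin n) O) * (s x.1 * B y) = s x.1 * (p * B y) := by
      rw [← mul_assoc, cm (s x.1), mul_assoc]
    rw [sub_mul, mul_sub, mul_sub, e2, sub_zero, ← sub_eq_zero, ← neg_eq_zero, ← e1, e3]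
    noncomm_ring
  · simp [hs, map_sub, map_mul]
  · rw [e0]
    simp [hs, u]

end GLC

namespace GLC
open Matrix

section
variable {F : Type} [Field F] {m : ℕ}

lemma gl_zero (n : ℕ) (hn : 1 ≤ n) : cd (glConj F n) 0 = 1 := by
  have : Nonempty (Fin n) := ⟨⟨0, by omega⟩⟩
  rw [cd_H0]
  let f : F →ₗ[F] (glConj F n).invariants := LinearMap.codRestrict _
    (LinearMap.toSpanSingleton F (Matrix (Fin n) (Fin n) F) 1) (by
      intro c g
      rw [glConj_apply]
      simp only [LinearMap.toSpanSingleton_apply, Matrix.mul_smul, Matrix.smul_mul, Matrix.mul_one]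
      rw [← Units.val_mul, mul_inv_cancel, Units.val_one])
  have hf : Function.Bijective f := by
    constructor
    · intro c d h
      have h1 : c • (1 : Matrix (Fin n) (Fin n) F) = d • 1 := congrArg Subtype.val h
      have h2 := congrFun (congrFun h1 ⟨0, by omega⟩) ⟨0, by omega⟩
      simpa using h2
    · rintro ⟨M, hM⟩
      obtain ⟨c, hc⟩ := Matrix.mem_range_scalar_of_commute_transvectionStruct (M := M) (fun t => by
        have h1 := hM (Units.mk _ _ t.mul_inv t.inv_mul)
        rw [glConj_apply] at h1
        have h2 : t.toMatrix * M * t.inv.toMatrix = M := h1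
        show t.toMatrix * M = M * t.toMatrix
        conv_rhs => rw [← h2]
        rw [Matrix.mul_assoc _ t.inv.toMatrix, t.inv_mul, Matrix.mul_one])
      refine ⟨c, Subtype.ext ?_⟩
      show c • (1 : Matrix (Fin n) (Fin n) F) = M
      rw [← hc, Matrix.smul_one_eq_diagonal]
      rfl
  rw [← (LinearEquiv.ofBijective f hf).length_eq, Module.length_eq_finrank]
  simp

lemma cd0_rs {K Γ Δ A : Type} [Field K] [Group Γ] [Group Δ] [AddCommGroup A] [Module K A]
    (φ : Δ →* Γ) (ρ : Representation K Γ A) : cd ρ 0 ≤ cd (rs φ ρ) 0 := by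
  rw [cd_H0, cd_H0]
  refine Module.length_le_of_injective (Submodule.inclusion (p := ρ.invariants) (p' := (rs φ ρ).invariants) ?_)
    (Submodule.inclusion_injective _)
  intro x hx g
  exact hx (φ g)

lemma homWW (j : ℕ) : cd (rs (inH F m) (homW (WW F m))) j = cd (glConj F m) j := by
  refine cd_iso (Matrix.transposeLinearEquiv (Fin m) (Fin m) F F) ?_ j
  intro g φ
  rw [glConj_apply]
  ext a b
  refine (congrFun (homW_apply (WW F m) (inH F m g) (fun i j => φ i j) b) a).trans ?_
  have e : ∀ c : Fin m, (WW F m (inH F m g) (φ c)) a = (g.1 * φᵀ) a c := by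
    intro c
    rfl
  rw [Finset.sum_apply, Matrix.mul_apply]
  refine Finset.sum_congr rfl fun c _ => ?_
  exact (congrArg (((g⁻¹).1 c b) * ·) (e c)).trans (mul_comm _ _)

section
variable {Y : Type} [AddCommGroup Y] [Module F Y]

/-- evaluation -/
def evW (φ : Fin m → Y) : (Fin m → F) →ₗ[F] Y := ∑ i, (LinearMap.proj i).smulRight (φ i)

lemma evW_apply (φ : Fin m → Y) (w : Fin m → F) : evW φ w = ∑ i, w i • φ i := by
  simp [evW]

lemma evW_add (φ ψ : Fin m → Y) (w : Fin m → F) : evW (φ + ψ) w = evW φ w + evW ψ w := by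
  simp [evW_apply, Finset.sum_add_distrib]

lemma evW_single (φ : Fin m → Y) (i : Fin m) : evW φ (Pi.single i (1 : F)) = φ i := by
  classical
  simp [evW_apply, Pi.single_apply]

lemma evW_homW (ρ : Representation F (PQ F m) Y) (g : PQ F m) (φ : Fin m → Y) (w : Fin m → F) :
    evW (homW ρ g φ) (g.h.1 *ᵥ w) = ρ g (evW φ w) := by
  simp only [evW_apply, map_sum, map_smul, Matrix.mulVec, dotProduct, Finset.sum_smul]
  rw [Finset.sum_comm]
  refine Finset.sum_congr rfl fun s _ => ?_
  rw [← homW_sum ρ g φ s, Finset.smul_sum]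
  exact Finset.sum_congr rfl fun i _ => by rw [smul_smul, mul_comm]

/-- extension attached to a cocycle -/
def EE (ρ : Representation F (PQ F m) Y) (f : PQ F m → Fin m → Y)
    (hf : ∀ x y, f (x * y) = homW ρ x (f y) + f x) : Representation F (PQ F m) (Y × (Fin m → F)) where
  toFun g :=
    { toFun := fun z => (ρ g z.1 + evW (f g) (g.h.1 *ᵥ z.2), g.h.1 *ᵥ z.2)
      map_add' := fun x y => by
        ext : 1
        · simp [Matrix.mulVec_add]; abel
        · simp [Matrix.mulVec_add]
      map_smul' := fun c x => by
        ext : 1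
        · simp [Matrix.mulVec_smul]
        · simp [Matrix.mulVec_smul] }
  map_one' := by
    have h1 : f 1 = 0 := by
      have := hf 1 1
      rw [map_one, mul_one] at this
      exact left_eq_add.1 this
    refine LinearMap.ext fun x => ?_
    ext : 1
    · simp [h1, evW_apply]
    · simp
  map_mul' x y := by
    refine LinearMap.ext fun z => ?_
    ext : 1
    · show ρ (x * y) z.1 + evW (f (x * y)) ((x * y).h.1 *ᵥ z.2) =
        ρ x (ρ y z.1 + evW (f y) (y.h.1 *ᵥ z.2)) + evW (f x) (x.h.1 *ᵥ (y.h.1 *ᵥ z.2))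
      rw [hf, evW_add, map_add, ← evW_homW, PQ.mul_h, Units.val_mul, ← Matrix.mulVec_mulVec, map_mul,
        Module.End.mul_apply, add_assoc]
    · simp

lemma EE_apply (ρ : Representation F (PQ F m) Y) (f : PQ F m → Fin m → Y) (hf) (g : PQ F m)
    (z : Y × (Fin m → F)) :
    EE ρ f hf g z = (ρ g z.1 + evW (f g) (g.h.1 *ᵥ z.2), g.h.1 *ᵥ z.2) := rfl

lemma E_ses (ρ : Representation F (PQ F m) Y) (f : PQ F m → Fin m → Y) (hf) :
    SES ρ (EE ρ f hf) (WW F m) (LinearMap.inl F Y (Fin m → F)) (LinearMap.snd F Y (Fin m → F)) := by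
  refine ⟨?_, ?_, LinearMap.inl_injective, LinearMap.snd_surjective, ?_⟩
  · intro g a; simp [EE_apply]
  · intro g a; rfl
  · intro b
    constructor
    · intro h; exact ⟨b.1, Prod.ext rfl h.symm⟩
    · rintro ⟨a, rfl⟩; rfl

lemma E_R0 (ρ : Representation F (PQ F m) Y) (f : PQ F m → Fin m → Y) (hf)
    (hnc : ¬ ∃ a, ∀ x, f x = homW ρ x a - a) (h0 : cd (rs (RR F m).subtype ρ) 0 = 0) :
    cd (rs (RR F m).subtype (EE ρ f hf)) 0 = 0 := by
  rw [cd_H0_zero] at h0 ⊢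
  intro z hz
  by_contra hz0
  let S := (rs (RR F m).subtype (EE ρ f hf)).invariants
  have uniq : ∀ d d' : Y, ∀ w, (d, w) ∈ S → (d', w) ∈ S → d = d' := by
    intro d d' w h1 h2
    rw [← sub_eq_zero]
    apply h0
    intro g
    have h3 := (S.sub_mem h1 h2) g
    have h4 := congrArg Prod.fst h3
    simpa [EE_apply] using h4
  have stab : ∀ g : PQ F m, ∀ x ∈ S, EE ρ f hf g x ∈ S := by
    intro g x hx r
    have hm : g⁻¹ * r.1 * g ∈ RR F m := by
      have := (inferInstance : (RR F m).Normal).conj_mem r.1 r.2 g⁻¹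
      simpa using this
    have h1 : EE ρ f hf (g⁻¹ * r.1 * g) x = x := hx ⟨_, hm⟩
    show EE ρ f hf r.1 (EE ρ f hf g x) = _
    conv_rhs => rw [← h1]
    rw [← Module.End.mul_apply, ← Module.End.mul_apply, ← map_mul, ← map_mul]
    congr 2
    group
  have hw : z.2 ≠ 0 := by
    intro h
    have h1 : (z.1, (0 : Fin m → F)) ∈ S := by rw [← h]; exact hz
    exact hz0 (Prod.ext (uniq _ _ _ h1 S.zero_mem) h)
  have ex : ∀ i : Fin m, ∃ d : Y, (d, (Pi.single i (1 : F) : Fin m → F)) ∈ S := by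
    intro i
    obtain ⟨g, hg⟩ := exists_gl z.2 (Pi.single i 1) hw (by simp)
    have h1 := stab (inH F m g) z hz
    rw [EE_apply] at h1
    have h2 : (inH F m g).h.1 *ᵥ z.2 = Pi.single i 1 := hg
    rw [h2] at h1
    exact ⟨_, h1⟩
  choose d hd using ex
  have hev : ∀ w : Fin m → F, (evW d w, w) ∈ S := by
    intro w
    have : (evW d w, w) = ∑ i, w i • (d i, (Pi.single i (1 : F) : Fin m → F)) := by
      refine Prod.ext ?_ ?_
      · rw [Prod.fst_sum, evW_apply]; rfl
      · rw [Prod.snd_sum]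
        simp only [Prod.smul_snd]
        funext l
        simp [Pi.single_apply]
    rw [this]
    exact S.sum_mem fun i _ => S.smul_mem _ (hd i)
  apply hnc
  refine ⟨-d, fun g => ?_⟩
  funext i
  have h1 := stab g _ (hev ((g.h⁻¹).1 *ᵥ Pi.single i 1))
  rw [EE_apply] at h1
  have e : g.h.1 *ᵥ ((g.h⁻¹).1 *ᵥ Pi.single i 1) = Pi.single i 1 := by
    rw [Matrix.mulVec_mulVec, ← Units.val_mul, mul_inv_cancel, Units.val_one, Matrix.one_mulVec]
  simp only [← evW_homW, e, evW_single] at h1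
  have h2 := uniq _ _ _ h1 (hd i)
  rw [map_neg]
  simp only [Pi.sub_apply, Pi.neg_apply]
  rw [← h2]
  abel

end
end

section
variable (F : Type) [Field F] (m : ℕ) [Fintype F] (p r : ℕ) [hp : Fact p.Prime] [CharP F p] (hq : Fintype.card F = p^r)
  (hp5 : 5 ≤ p)
include hq hp5

lemma homF (j : ℕ) : cd (homW (FF F m)) j = 0 := cd_homW _ j fun i _ => F_R F m p r hq hp5 i

lemma homV_le (j : ℕ) : cd (homW (VV F m)) (j+1) ≤ cd (homW (DD F m)) j := by
  refine ((D_ses (F := F) (m := m)).homW.A1 j).trans ?_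
  rw [homF F m p r hq hp5, add_zero]

lemma homD_le (hm : 1 ≤ m) (j : ℕ) (hj : j ≤ 1) : cd (homW (DD F m)) (j+1) ≤ cd (homW (WW F m)) j := by
  have h1 : cd (homW (DD F m)) 1 ≠ 0 := by
    intro h
    have h2 := (gl_le F m p r hq hp5 2 (by omega) (by omega)).trans (homV_le F m p r hq hp5 1)
    rw [h] at h2
    exact gl_two_ne F p hp5 (m+1) (by omega) (le_antisymm h2 zero_le)
  obtain ⟨f, hf, hnc⟩ := cd1_ne h1
  have hs := E_ses (DD F m) f hf
  have hsR := hs.rs (RR F m).subtype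
  have e0 := E_R0 (DD F m) f hf hnc (D_R0 F m p r hq hp5)
  have e1 : cd (rs (RR F m).subtype (EE (DD F m) f hf)) 1 = 0 := by
    have hD := D_R1 F m p r hq hp5
    have := hsR.refd e0 (by rw [WW_R0]; exact hD) (ne_top_of_le_ne_top (by simp) hD)
    rw [W_R F m p r hq hp5 1 le_rfl (by omega)] at this
    exact le_antisymm this zero_le
  have e2 : cd (rs (RR F m).subtype (EE (DD F m) f hf)) 2 = 0 := by
    refine le_antisymm ((hsR.mid 2).trans ?_) zero_le
    rw [W_R F m p r hq hp5 2 (by omega) (by omega), D_R2 F m p r hq hp5, add_zero]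
  have hE : cd (homW (EE (DD F m) f hf)) (j+1) = 0 := by
    refine cd_homW _ _ fun i hi => ?_
    obtain rfl | rfl | rfl : i = 0 ∨ i = 1 ∨ i = 2 := by omega
    · exact e0
    · exact e1
    · exact e2
  refine (hs.homW.A1 j).trans ?_
  rw [hE, add_zero]

lemma homW0 (hm : 1 ≤ m) : cd (homW (WW F m)) 0 ≤ 1 := by
  rw [← gl_zero (F := F) m hm, ← homWW]
  exact cd0_rs _ _

lemma homW1 : cd (homW (WW F m)) 1 = 0 := by
  refine lemCQ 0 _ ?_ ?_ ?_
  · intro g hg x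
    have hg' : g.h = 1 := hg
    funext i
    rw [homW_apply, hg']
    simp [Matrix.one_apply, hg']
  · intro i h1 h2
    exact cd_homW_R _ _ (W_R F m p r hq hp5 i h1 (by omega))
  · intro i h1 h2
    obtain rfl : i = 1 := by omega
    rw [homWW]
    exact gl_one F m p r hq hp5

lemma gl_two (hm : 1 ≤ m) : cd (glConj F (m+1)) 2 = 1 := by
  refine le_antisymm ?_ (Order.one_le_iff_ne_zero.2 (gl_two_ne F p hp5 (m+1) (by omega)))
  exact (gl_le F m p r hq hp5 2 (by omega) (by omega)).trans ((homV_le F m p r hq hp5 1).trans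
    ((homD_le F m p r hq hp5 hm 0 (by omega)).trans (homW0 F m p r hq hp5 hm)))

lemma gl_three (hm : 1 ≤ m) : cd (glConj F (m+1)) 3 = 0 := by
  refine le_antisymm ?_ zero_le
  exact (gl_le F m p r hq hp5 3 (by omega) (by omega)).trans ((homV_le F m p r hq hp5 2).trans
    ((homD_le F m p r hq hp5 hm 1 (by omega)).trans (homW1 F m p r hq hp5).le))

end
end GLC

/-- Friedlander–Evens: low-degree cohomology of `GL(n,k)` with adjoint coefficients,
for `k` finite of characteristic `p ≥ 5` and `n ≥ 2`. -/
theorem gl_cohomology_adjoint_low_degrees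
    (k : Type) [Field k] [Fintype k] (p : ℕ) [CharP k p] (hp : 5 ≤ p)
    (n : ℕ) (hn : 2 ≤ n) :
    Module.finrank k (groupCohomology (Rep.of (glConj k n)) 0) = 1 ∧
    Subsingleton (groupCohomology (Rep.of (glConj k n)) 1) ∧
    Module.finrank k (groupCohomology (Rep.of (glConj k n)) 2) = 1 ∧
    Subsingleton (groupCohomology (Rep.of (glConj k n)) 3) := by
  obtain ⟨r, hpp, hq⟩ := FiniteField.card k p
  have : Fact p.Prime := ⟨hpp⟩
  obtain ⟨m, rfl⟩ : ∃ m, n = m + 1 := ⟨n - 1, by omega⟩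
  refine ⟨?_, ?_, ?_, ?_⟩
  · exact isSimpleModule_iff_finrank_eq_one.1 (Module.length_eq_one_iff.1
      (GLC.gl_zero (F := k) (m+1) (by omega)))
  · exact Module.length_eq_zero_iff.1 (GLC.gl_one k (m+1) p r hq hp)
  · exact isSimpleModule_iff_finrank_eq_one.1 (Module.length_eq_one_iff.1
      (GLC.gl_two k m p r hq hp (by omega)))
  · exact Module.length_eq_zero_iff.1 (GLC.gl_three k m p r hq hp (by omega))
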